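/- arXiv:1312.5668 — 3 statements merged into one kernel-verified Lean document; each statement's English description precedes it below -/
import Mathlib

section
/- Let D be a division ring of quotients of the first Weyl algebra over ℚ, with generators s, t ∈ D satisfying st − ts = 1. (a) If * is a ℚ-involution on D with s* = −t and t* = −s, then the multiplicative group D^× contains a free symmetric pair. (b) If * is a ℚ-involution on D with s* = −s and t* = t, then D^× contains a free unitary pair. -/
/-- A pair of elements of a group is free if the induced map from the free group
on two generators is injective. -/
def IsFreePair {G : Type*} [Group G] (u v : G) : Prop :=
  Function.Injective ⇑(FreeGroup.lift (fun b : Bool => if b then u else v) : FreeGroup Bool →* G)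

section Helpers

open Polynomial Matrix

/-- The sum `∑ pᵢ(x) yⁱ` attached to a polynomial `∑ pᵢ Yⁱ` with coefficients in `ℤ[X]`. -/
noncomputable def skewEval {R : Type*} [Ring R] (x y : R) : ℤ[X][X] →+ R :=
  eval₂AddMonoidHom (aeval x : ℤ[X] →ₐ[ℤ] R).toRingHom y

section SkewEval

variable {R : Type*} [Ring R] {x y : R}

lemma skewEval_monomial (n : ℕ) (p : ℤ[X]) :
    skewEval x y (monomial n p) = aeval x p * y ^ n := by
  simp [skewEval, eval₂_monomial]

lemma skewEval_C (p : ℤ[X]) : skewEval x y (C p) = aeval x p := by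
  simpa using skewEval_monomial (x := x) (y := y) 0 p

lemma skewEval_X : skewEval x y X = y := by
  simpa [monomial_one_one_eq_X] using skewEval_monomial (x := x) (y := y) 1 1

lemma skewEval_monomial' (n : ℕ) (p : ℤ[X]) :
    skewEval x y (monomial n p) = skewEval x y (C p) * y ^ n := by
  rw [skewEval_monomial, skewEval_C]

lemma skewEval_C_C (a : ℤ) : skewEval x y (C (C a)) = a := by
  rw [skewEval_C, aeval_C, eq_intCast]

lemma skewEval_C_mul_X (p : ℤ[X]) : skewEval x y (C (p * X)) = skewEval x y (C p) * x := by
  rw [skewEval_C, skewEval_C, map_mul, aeval_X]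

lemma map_skewEval {S : Type*} [Ring S] (f : R →+* S) (P : ℤ[X][X]) :
    f (skewEval x y P) = skewEval (f x) (f y) P := by
  induction P using Polynomial.induction_on' with
  | add p q hp hq => simp [hp, hq]
  | monomial n a =>
    have h : f (aeval x a) = aeval (f x) a :=
      (aeval_algHom_apply f.toIntAlgHom x a).symm
    simp [skewEval_monomial, h]

lemma aeval_mul_skewEval (p : ℤ[X]) (P : ℤ[X][X]) :
    aeval x p * skewEval x y P = skewEval x y (C p * P) := by
  induction P using Polynomial.induction_on' with
  | add p q hp hq => simp [hp, hq, mul_add]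
  | monomial n a => simp [skewEval_monomial, C_mul_monomial, mul_assoc]

lemma skewEval_mul_X (P : ℤ[X][X]) : skewEval x y (P * X) = skewEval x y P * y := by
  induction P using Polynomial.induction_on' with
  | add p q hp hq => simp [hp, hq, add_mul]
  | monomial n a => simp [skewEval_monomial, monomial_mul_X, mul_assoc, pow_succ]

lemma mul_aeval_of_skew {x' : R} (h : y * x = x' * y) (p : ℤ[X]) :
    y * aeval x p = aeval x' p * y := by
  induction p using Polynomial.induction_on' with
  | add p q hp hq => simp [hp, hq, mul_add, add_mul]
  | monomial n a =>
    have hn : y * x ^ n = x' ^ n * y := SemiconjBy.pow_right (show SemiconjBy y x x' from h) n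
    have ha : y * (a : R) = a * y := (Int.cast_commute a y).eq.symm
    simp only [aeval_monomial, eq_intCast]
    rw [← mul_assoc, ha, mul_assoc, hn, mul_assoc]

lemma mul_skewEval (h : y * x = (x + 1) * y) (P : ℤ[X][X]) :
    y * skewEval x y P = skewEval x y (P.map (compRingHom (X + 1)) * X) := by
  rw [skewEval_mul_X]
  induction P using Polynomial.induction_on' with
  | add p q hp hq => simp [hp, hq, mul_add, add_mul]
  | monomial n a =>
    have := mul_aeval_of_skew h a
    rw [skewEval_monomial, ← mul_assoc, this]
    simp [skewEval_monomial, aeval_comp, mul_assoc, ← pow_succ, ← pow_succ']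

lemma skewEval_mul_eq (h : y * x = (x + 1) * y) (P : ℤ[X][X]) :
    skewEval x y P * y = y * skewEval x y (P.map (compRingHom (X - 1))) := by
  rw [mul_skewEval h, skewEval_mul_X, Polynomial.map_map]
  have : (compRingHom (X + 1)).comp (compRingHom (X - 1)) = RingHom.id ℤ[X] :=
    RingHom.ext fun q => by simp [comp_assoc]
  rw [this, Polynomial.map_id]

lemma exists_skewEval_mul (h : y * x = (x + 1) * y) (P Q : ℤ[X][X]) :
    ∃ T, skewEval x y T = skewEval x y P * skewEval x y Q := by
  induction P using Polynomial.induction_on' with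
  | add p q hp hq =>
    obtain ⟨S, hS⟩ := hp
    obtain ⟨T, hT⟩ := hq
    exact ⟨S + T, by simp [hS, hT, add_mul]⟩
  | monomial n a =>
    have hy : ∀ n : ℕ, ∃ T, skewEval x y T = y ^ n * skewEval x y Q := by
      intro n
      induction n with
      | zero => exact ⟨Q, by simp⟩
      | succ n ih =>
        obtain ⟨T, hT⟩ := ih
        exact ⟨_, by rw [pow_succ', mul_assoc, ← hT, mul_skewEval h]⟩
    obtain ⟨T, hT⟩ := hy n
    exact ⟨C a * T, by rw [← aeval_mul_skewEval, hT, skewEval_monomial, mul_assoc]⟩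

/-- The subring generated by `x` and `y` when `y * x = (x + 1) * y`. -/
noncomputable def skewSubring (h : y * x = (x + 1) * y) : Subring R where
  carrier := Set.range (skewEval x y)
  mul_mem' := by
    rintro _ _ ⟨P, rfl⟩ ⟨Q, rfl⟩
    exact exists_skewEval_mul h P Q
  one_mem' := ⟨1, by simpa using skewEval_C (x := x) (y := y) 1⟩
  add_mem' := by
    rintro _ _ ⟨P, rfl⟩ ⟨Q, rfl⟩
    exact ⟨P + Q, map_add _ _ _⟩
  zero_mem' := ⟨0, map_zero _⟩
  neg_mem' := by
    rintro _ ⟨P, rfl⟩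
    exact ⟨-P, map_neg _ _⟩

lemma left_mem_skewSubring (h : y * x = (x + 1) * y) : x ∈ skewSubring h :=
  ⟨C X, by simp [skewEval_C]⟩

lemma right_mem_skewSubring (h : y * x = (x + 1) * y) : y ∈ skewSubring h :=
  ⟨X, skewEval_X⟩

lemma exists_mul_pow_eq (h : y * x = (x + 1) * y) {b : R} (hb : b ∈ skewSubring h) (n : ℕ) :
    ∃ b' ∈ skewSubring h, b * y ^ n = y ^ n * b' := by
  induction n with
  | zero => exact ⟨b, hb, by simp⟩
  | succ n ih =>
    obtain ⟨_, ⟨P, rfl⟩, hP⟩ := ih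
    exact ⟨_, ⟨P.map (compRingHom (X - 1)), rfl⟩, by
      rw [pow_succ, ← mul_assoc, hP, mul_assoc, skewEval_mul_eq h, mul_assoc]⟩

lemma bracket_skewEval (h : y * x = (x + 1) * y) (P : ℤ[X][X]) :
    skewEval x y P * x - x * skewEval x y P = skewEval x y (derivative P) * y := by
  rw [← skewEval_mul_X]
  induction P using Polynomial.induction_on' with
  | add p q hp hq =>
    simp only [map_add, add_mul, mul_add, ← hp, ← hq]
    abel
  | monomial n a =>
    have hn : y ^ n * x = (x + n) * y ^ n := by
      induction n with
      | zero => simp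
      | succ n ih =>
        rw [pow_succ', mul_assoc, ih, ← mul_assoc, mul_add, h, (Nat.cast_commute n y).eq.symm,
          ← mul_assoc]
        push_cast
        noncomm_ring
    have hx : aeval x a * x = x * aeval x a := by
      simpa using congrArg (aeval x) (mul_comm a X)
    rcases n with _ | n
    · simp [skewEval_C, hx]
    · rw [derivative_monomial, monomial_mul_X, skewEval_monomial, skewEval_monomial, mul_assoc, hn]
      simp only [Nat.add_sub_cancel, map_mul, map_natCast]
      rw [← mul_assoc x, ← hx]
      noncomm_ring

end SkewEval

lemma aeval_ne_zero_of_skew {D : Type*} [DivisionRing D] [Algebra ℚ D] {x y : D} (hy : y ≠ 0)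
    (h : y * x = (x + 1) * y) {p : ℤ[X]} (hp : p ≠ 0) : aeval x p ≠ 0 := by
  intro h0
  have hint : IsIntegral ℚ x := by
    refine IsAlgebraic.isIntegral ⟨p.map (Int.castRingHom ℚ), ?_, ?_⟩
    · exact (Polynomial.map_ne_zero_iff (Int.castRingHom ℚ).injective_int).2 hp
    · rw [← h0]; exact aeval_map_algebraMap ℚ x p
  set m := minpoly ℚ x with hm
  have hsh : aeval x (m.comp (X + 1)) = 0 := by
    have key : ∀ q : ℚ[X], y * aeval x q = aeval (x + 1) q * y := by
      intro q
      induction q using Polynomial.induction_on' with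
      | add p q hp hq => simp [hp, hq, mul_add, add_mul]
      | monomial n a =>
        have hn : y * x ^ n = (x + 1) ^ n * y :=
          SemiconjBy.pow_right (show SemiconjBy y x (x + 1) from h) n
        rw [aeval_monomial, aeval_monomial, ← mul_assoc, ← Algebra.commutes, mul_assoc, hn,
          mul_assoc]
    have := key m
    rw [hm, minpoly.aeval, mul_zero] at this
    rw [aeval_comp]
    simpa [hy] using this.symm
  have hmon : (m.comp (X + 1)).Monic := by
    simpa using (minpoly.monic hint).comp_X_add_C 1
  have heq : m.comp (X + 1) = m := by
    refine eq_of_monic_of_dvd_of_natDegree_le (minpoly.monic hint) hmon (minpoly.dvd ℚ x hsh) ?_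
    have : (X + 1 : ℚ[X]).natDegree = 1 := natDegree_X_add_C 1
    rw [natDegree_comp, this, mul_one]
  have hval : ∀ n : ℕ, m.eval (n : ℚ) = m.eval 0 := by
    intro n
    induction n with
    | zero => simp
    | succ n ih =>
      rw [← ih]
      conv_rhs => rw [← heq]
      simp
  have hc : m = C (m.eval 0) := by
    refine eq_of_infinite_eval_eq _ _ ((Set.infinite_range_of_injective
      (Nat.cast_injective (R := ℚ))).mono ?_)
    rintro _ ⟨n, rfl⟩
    simp [hval]
  have := minpoly.natDegree_pos hint
  rw [← hm, hc, natDegree_C] at this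
  exact lt_irrefl _ this

lemma skewEval_injective {D : Type*} [DivisionRing D] [Algebra ℚ D] {x y : D} (hy : y ≠ 0)
    (h : y * x = (x + 1) * y) {P : ℤ[X][X]} (hP : skewEval x y P = 0) : P = 0 := by
  induction hn : P.natDegree using Nat.strong_induction_on generalizing P with
  | _ n ih =>
    have hd := bracket_skewEval h P
    rw [hP, zero_mul, mul_zero, sub_zero, eq_comm, mul_eq_zero, or_iff_left hy] at hd
    have hd0 : P.natDegree = 0 := by
      by_contra h0
      have := ih _ (hn ▸ natDegree_derivative_lt h0) hd rfl
      exact h0 (derivative_eq_zero.1 this)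
    rw [eq_C_of_natDegree_eq_zero hd0] at hP ⊢
    rw [skewEval_C] at hP
    by_contra h0
    exact aeval_ne_zero_of_skew hy h (fun h1 => h0 (by rw [h1, C_0])) hP

section Fractions

variable {D M : Type*} [Ring D] [Ring M]

/-- The units `a * b⁻¹` with `a` and `b` in the subring `A`, under a right Ore condition. -/
def fractionSubgroup (A : Subring M)
    (hore : ∀ a ∈ A, ∀ b ∈ A, IsUnit b → ∃ c ∈ A, IsUnit c ∧ ∃ e ∈ A, a * c = b * e) :
    Subgroup Mˣ where
  carrier := {p | ∃ a ∈ A, ∃ b ∈ A, IsUnit b ∧ (p : M) * b = a}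
  mul_mem' := by
    rintro p q ⟨a, ha, b, hb, hbu, hp⟩ ⟨a', ha', b', hb', hbu', hq⟩
    obtain ⟨c, hc, hcu, e, he, hce⟩ := hore a' ha' b hb hbu
    refine ⟨a * e, A.mul_mem ha he, b' * c, A.mul_mem hb' hc, hbu'.mul hcu, ?_⟩
    rw [← hp, mul_assoc (p : M), ← hce, ← hq, Units.val_mul]
    simp only [mul_assoc]
  one_mem' := ⟨1, A.one_mem, 1, A.one_mem, isUnit_one, by simp⟩
  inv_mem' := by
    rintro p ⟨a, ha, b, hb, hbu, hp⟩
    exact ⟨b, hb, a, ha, hp ▸ p.isUnit.mul hbu, by rw [← hp, Units.inv_mul_cancel_left]⟩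

lemma mem_fractionSubgroup {A : Subring M}
    (hore : ∀ a ∈ A, ∀ b ∈ A, IsUnit b → ∃ c ∈ A, IsUnit c ∧ ∃ e ∈ A, a * c = b * e)
    {p : Mˣ} (hp : (p : M) ∈ A) : p ∈ fractionSubgroup A hore :=
  ⟨p, hp, 1, A.one_mem, isUnit_one, by simp⟩

lemma lift_ite_map {G N : Type*} [Group G] [Group N] (f : G →* N) (p q : G) (w : FreeGroup Bool) :
    FreeGroup.lift (fun b : Bool => if b then f p else f q) w =
      f (FreeGroup.lift (fun b : Bool => if b then p else q) w) := by
  rw [← MonoidHom.comp_apply]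
  congr 1
  ext b
  cases b <;> simp

/-- Freeness of a pair lifts along the projection of a fraction group to the second factor, when
the first projection is injective on the subring of denominators. -/
lemma isFreePair_fst_of_snd {A : Subring (D × M)}
    (hore : ∀ a ∈ A, ∀ b ∈ A, IsUnit b → ∃ c ∈ A, IsUnit c ∧ ∃ e ∈ A, a * c = b * e)
    (hA : ∀ a ∈ A, a.1 = 0 → a.2 = 0) {p q : (D × M)ˣ}
    (hp : p ∈ fractionSubgroup A hore) (hq : q ∈ fractionSubgroup A hore)
    (hfree : IsFreePair (Units.map (RingHom.snd D M : D × M →* M) p)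
      (Units.map (RingHom.snd D M : D × M →* M) q)) :
    IsFreePair (Units.map (RingHom.fst D M : D × M →* D) p)
      (Units.map (RingHom.fst D M : D × M →* D) q) := by
  unfold IsFreePair at hfree ⊢
  rw [injective_iff_map_eq_one] at hfree ⊢
  intro w hw
  apply hfree
  rw [lift_ite_map] at hw ⊢
  set r := FreeGroup.lift (fun b : Bool => if b then p else q) w with hr
  have hmem : r ∈ fractionSubgroup A hore := by
    refine FreeGroup.range_lift_le ?_ ⟨w, hr.symm⟩
    rintro _ ⟨b, rfl⟩
    cases b <;> simpa
  obtain ⟨a, ha, b, hb, hbu, hrb⟩ := hmem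
  have hr1 : (r : D × M).1 = 1 := by simpa [Units.ext_iff] using hw
  have h2 := hA (a - b) (A.sub_mem ha hb) (by rw [← hrb]; simp [hr1])
  rw [← hrb, Prod.snd_sub, Prod.snd_mul, sub_eq_zero] at h2
  have hb2 : IsUnit b.2 := hbu.map (RingHom.snd D M)
  have : (r : D × M).2 = 1 := hb2.mul_right_cancel (by rw [h2, one_mul])
  exact Units.ext this

end Fractions

section RankOne

variable {R k K : Type*} [CommRing R] [CommRing k] [IsDomain k] [Field K] [Algebra R K]

lemma exists_prod_eq_smul_vecMulVec {ι : Type*} (c r : ι → Fin 2 → k) (rel : ι → ι → Prop)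
    (hne : ∀ l l', rel l l' → r l ⬝ᵥ c l' ≠ 0) (l : ι) (L : List ι)
    (hL : (l :: L).IsChain rel) :
    ∃ κ : k, κ ≠ 0 ∧ ∃ l' : ι,
      ((l :: L).map fun i => vecMulVec (c i) (r i)).prod = κ • vecMulVec (c l) (r l') := by
  induction L generalizing l with
  | nil => exact ⟨1, one_ne_zero, l, by simp⟩
  | cons m L ih =>
    rw [List.isChain_cons_cons] at hL
    obtain ⟨κ, hκ, l', h⟩ := ih m hL.2
    refine ⟨κ * (r l ⬝ᵥ c m), mul_ne_zero hκ (hne l m hL.1), l', ?_⟩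
    rw [List.map_cons, List.prod_cons, h, Matrix.mul_smul, vecMulVec_mul_vecMulVec,
      mul_smul]
    congr 1
    ext i j
    simp only [vecMulVec_apply, Pi.smul_apply, Matrix.smul_apply, smul_eq_mul]
    ring

lemma vecMulVec_fin_two_ne_scalar {c r : Fin 2 → k} (hc : c ≠ 0) (hr : r ≠ 0)
    (h01 : vecMulVec c r 0 1 = 0) (h10 : vecMulVec c r 1 0 = 0)
    (hd : vecMulVec c r 0 0 = vecMulVec c r 1 1) : False := by
  simp only [vecMulVec_apply] at *
  apply hc
  have hr' : r 0 ≠ 0 ∨ r 1 ≠ 0 := by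
    by_contra! h
    exact hr (by ext i; fin_cases i <;> simp [h])
  have h0 : c 0 = 0 ∧ c 1 = 0 := by
    simp only [mul_eq_zero] at h01 h10
    rcases hr' with h | h
    · have h1 := h10.resolve_right h
      exact ⟨by simpa [h1, h] using hd, h1⟩
    · have h1 := h01.resolve_right h
      exact ⟨h1, by simpa [h1, h] using hd⟩
  ext i
  fin_cases i <;> simp [h0]

lemma injective_lift_of_rank_one (hinj : Function.Injective (algebraMap R K)) (ev : R →+* k)
    (X : Bool → (Matrix (Fin 2) (Fin 2) K)ˣ) (N : Bool × Bool → Matrix (Fin 2) (Fin 2) R)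
    (c r : Bool × Bool → Fin 2 → k)
    (hN : ∀ b, ∃ κ : K, (X b : Matrix (Fin 2) (Fin 2) K) = κ • (N (b, true)).map (algebraMap R K))
    (hN' : ∀ b, ∃ κ : K, ((X b)⁻¹ : (Matrix (Fin 2) (Fin 2) K)ˣ).val =
      κ • (N (b, false)).map (algebraMap R K))
    (hev : ∀ l, (N l).map ev = vecMulVec (c l) (r l))
    (hne : ∀ l l' : Bool × Bool, (l.1 = l'.1 → l.2 = l'.2) → r l ⬝ᵥ c l' ≠ 0) :
    Function.Injective (FreeGroup.lift X) := by
  rw [injective_iff_map_eq_one]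
  intro w hw
  by_contra hw1
  have hred : w.toWord.IsChain fun a b => a.1 = b.1 → a.2 = b.2 := FreeGroup.isReduced_toWord
  obtain ⟨l, L, hlL⟩ := List.exists_cons_of_ne_nil (mt FreeGroup.toWord_eq_nil_iff.1 hw1)
  rw [hlL] at hred
  have hprod : ∀ L : List (Bool × Bool), ∃ κ : K,
      ((FreeGroup.lift X (FreeGroup.mk L) : (Matrix (Fin 2) (Fin 2) K)ˣ) :
        Matrix (Fin 2) (Fin 2) K) = κ • ((L.map N).prod).map (algebraMap R K) := by
    intro L
    induction L with
    | nil => exact ⟨1, by simp [← FreeGroup.one_eq_mk]⟩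
    | cons a L ih =>
      obtain ⟨κ, hκ⟩ := ih
      have ha : ∃ μ : K, ((cond a.2 (X a.1) (X a.1)⁻¹ : (Matrix (Fin 2) (Fin 2) K)ˣ) :
          Matrix (Fin 2) (Fin 2) K) = μ • (N a).map (algebraMap R K) := by
        rcases a with ⟨b, _ | _⟩
        · exact hN' b
        · exact hN b
      obtain ⟨μ, hμ⟩ := ha
      refine ⟨μ * κ, ?_⟩
      rw [FreeGroup.lift_mk] at hκ ⊢
      rw [List.map_cons, List.prod_cons, Units.val_mul, hκ, hμ, List.map_cons, List.prod_cons,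
        Matrix.map_mul, Matrix.smul_mul, Matrix.mul_smul, smul_smul]
  obtain ⟨κ, hκ⟩ := hprod (l :: L)
  rw [← hlL, FreeGroup.mk_toWord, hw, hlL, Units.val_one] at hκ
  obtain ⟨μ, hμ, l', hl'⟩ := exists_prod_eq_smul_vecMulVec c r _ hne l L hred
  set Q := ((l :: L).map N).prod with hQ
  have hQev : Q.map ev = μ • vecMulVec (c l) (r l') := by
    rw [← hl', hQ, ← RingHom.mapMatrix_apply, map_list_prod, List.map_map]
    congr 1
    exact List.map_congr_left fun i _ => hev i
  have e00 := congrFun (congrFun hκ 0) 0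
  have e11 := congrFun (congrFun hκ 1) 1
  have e01 := congrFun (congrFun hκ 0) 1
  have e10 := congrFun (congrFun hκ 1) 0
  simp only [Matrix.one_apply, Matrix.smul_apply, Matrix.map_apply, smul_eq_mul] at e00 e11 e01 e10
  norm_num at e00 e11 e01 e10
  have hκ0 : κ ≠ 0 := by
    rintro rfl
    simp at e00
  have q01 : Q 0 1 = 0 := hinj (by simpa [hκ0] using e01)
  have q10 : Q 1 0 = 0 := hinj (by simpa [hκ0] using e10)
  have qd : Q 0 0 = Q 1 1 := hinj (mul_left_cancel₀ hκ0 (e00.symm.trans e11))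
  have f : ∀ i j, ev (Q i j) = μ * vecMulVec (c l) (r l') i j := fun i j => by
    simpa using congrFun (congrFun hQev i) j
  have hcl : c l ≠ 0 := fun h => hne l l (fun _ => rfl) (by simp [h])
  have hrl : r l' ≠ 0 := fun h => hne l' l' (fun _ => rfl) (by simp [h])
  refine vecMulVec_fin_two_ne_scalar hcl hrl ?_ ?_ ?_
  · simpa [q01, hμ] using (f 0 1).symm
  · simpa [q10, hμ] using (f 1 0).symm
  · exact mul_left_cancel₀ hμ (by rw [← f, ← f, qd])

end RankOne

section ModTwo

/-- The matrix `diag(x, x + 1)` over `𝔽₂[x][y]`. -/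
noncomputable def diagMat : Matrix (Fin 2) (Fin 2) (ZMod 2)[X][X] := !![C X, 0; 0, C X + 1]

/-- The matrix over `𝔽₂[x][y]` exchanging the two basis vectors and multiplying them by `y`. -/
noncomputable def swapMat : Matrix (Fin 2) (Fin 2) (ZMod 2)[X][X] := !![0, X; X, 0]

lemma two_eq_zero_poly : (2 : (ZMod 2)[X][X]) = 0 := by
  have h : (2 : ZMod 2) = 0 := rfl
  rw [show (2 : (ZMod 2)[X][X]) = C (C 2) from (by simp only [map_ofNat]), h, C_0, C_0]

lemma swapMat_mul_diagMat : swapMat * diagMat = (diagMat + 1) * swapMat := by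
  have h2 := two_eq_zero_poly
  ext1 i j
  fin_cases i <;> fin_cases j <;>
    simp [swapMat, diagMat, Matrix.mul_apply, Fin.sum_univ_two] <;>
    first | ring1 | linear_combination -h2

/-- The matrix `diag(q(x), q(x + 1)) σⁿ` over `𝔽₂[x]`, where `σ` exchanges the basis vectors. -/
noncomputable def coeffMat (q : ℤ[X]) (n : ℕ) : Matrix (Fin 2) (Fin 2) (ZMod 2)[X] :=
  diagonal ![q.map (Int.castRingHom (ZMod 2)), (q.map (Int.castRingHom (ZMod 2))).comp (X + 1)] *
    !![0, 1; 1, 0] ^ n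

lemma skewEval_C_diagMat (q : ℤ[X]) : skewEval diagMat swapMat (C q) =
    (diagonal ![q.map (Int.castRingHom (ZMod 2)),
      (q.map (Int.castRingHom (ZMod 2))).comp (X + 1)]).map C := by
  induction q using Polynomial.induction_on with
  | C a =>
    rw [skewEval_C_C, ← Matrix.diagonal_intCast]
    ext1 i j
    fin_cases i <;> fin_cases j <;> simp
  | add p q hp hq =>
    ext1 i j
    rw [C_add, map_add, hp, hq]
    fin_cases i <;> fin_cases j <;> simp
  | monomial n a ih =>
    rw [pow_succ, ← mul_assoc, skewEval_C_mul_X, ih]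
    ext1 i j
    fin_cases i <;> fin_cases j <;> simp [diagMat, Matrix.mul_apply, Fin.sum_univ_two, mul_assoc]

lemma swapMat_pow (n : ℕ) :
    swapMat ^ n = (X : (ZMod 2)[X][X]) ^ n •
      ((!![0, 1; 1, 0] : Matrix (Fin 2) (Fin 2) (ZMod 2)[X]) ^ n).map C := by
  have h : swapMat = (X : (ZMod 2)[X][X]) •
      (C : (ZMod 2)[X] →+* (ZMod 2)[X][X]).mapMatrix !![0, 1; 1, 0] := by
    ext1 i j
    fin_cases i <;> fin_cases j <;> simp [swapMat]
  rw [h, _root_.smul_pow, ← map_pow]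
  rfl

lemma coeff_skewEval (P : ℤ[X][X]) (i j : Fin 2) (m : ℕ) :
    (skewEval diagMat swapMat P i j).coeff m = coeffMat (P.coeff m) m i j := by
  induction P using Polynomial.induction_on' with
  | add p q hp hq =>
    rw [map_add, Matrix.add_apply, coeff_add, coeff_add, hp, hq]
    have : ∀ a b : ℤ[X], coeffMat (a + b) m = coeffMat a m + coeffMat b m := by
      intro a b
      rw [coeffMat, coeffMat, coeffMat, ← add_mul]
      congr 1
      ext1 i j
      fin_cases i <;> fin_cases j <;> simp
    rw [this, Matrix.add_apply]
  | monomial n a =>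
    rw [skewEval_monomial', skewEval_C_diagMat, swapMat_pow, Matrix.mul_smul, ← Matrix.map_mul,
      Matrix.smul_apply, Matrix.map_apply, smul_eq_mul, mul_comm, coeff_C_mul, coeff_X_pow,
      coeff_monomial]
    rcases eq_or_ne m n with rfl | h
    · simp [coeffMat]
    · have h0 : coeffMat 0 m = 0 := by
        rw [coeffMat]
        convert zero_mul _
        ext1 i j
        fin_cases i <;> fin_cases j <;> simp
      simp [h, h.symm, h0]

lemma coeffMat_eq_zero {q : ℤ[X]} (hq : q.map (Int.castRingHom (ZMod 2)) = 0) (n : ℕ) :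
    coeffMat q n = 0 := by
  rw [coeffMat, hq]
  convert zero_mul _
  ext1 i j
  fin_cases i <;> fin_cases j <;> simp

lemma det_coeffMat_ne_zero {q : ℤ[X]} (hq : q.map (Int.castRingHom (ZMod 2)) ≠ 0) (n : ℕ) :
    (coeffMat q n).det ≠ 0 := by
  have h1 : (q.map (Int.castRingHom (ZMod 2))).comp (X + 1) ≠ 0 := by
    intro h
    apply hq
    have := congrArg (fun p => p.comp (X - 1)) h
    simpa [comp_assoc] using this
  rw [coeffMat, det_mul, det_diagonal, det_pow, Fin.prod_univ_two, det_fin_two_of]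
  simp [hq, h1]

lemma det_skewEval_ne_zero {P : ℤ[X][X]}
    (hP : P.map (mapRingHom (Int.castRingHom (ZMod 2))) ≠ 0) :
    (skewEval diagMat swapMat P).det ≠ 0 := by
  set n := (P.map (mapRingHom (Int.castRingHom (ZMod 2)))).natDegree with hn
  have hlead : (P.coeff n).map (Int.castRingHom (ZMod 2)) ≠ 0 := by
    have := leadingCoeff_ne_zero.2 hP
    rwa [leadingCoeff, ← hn, coeff_map] at this
  have hdeg : ∀ i j, (skewEval diagMat swapMat P i j).natDegree ≤ n := by
    intro i j
    rw [natDegree_le_iff_coeff_eq_zero]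
    intro m hm
    have h0 := coeff_eq_zero_of_natDegree_lt (hn ▸ hm)
    rw [coeff_map] at h0
    rw [coeff_skewEval, coeffMat_eq_zero h0]
    rfl
  intro h
  apply det_coeffMat_ne_zero hlead n
  have := congrArg (fun f => f.coeff (n + n)) h
  simpa only [det_fin_two, coeff_sub, coeff_zero, coeff_skewEval,
    coeff_mul_add_eq_of_natDegree_le (hdeg _ _) (hdeg _ _)] using this

lemma exists_eq_two_mul {P : ℤ[X][X]}
    (hP : P.map (mapRingHom (Int.castRingHom (ZMod 2))) = 0) : ∃ Q, P = 2 * Q := by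
  have h : C (C (2 : ℤ)) ∣ P := by
    rw [C_dvd_iff_dvd_coeff]
    intro i
    rw [C_dvd_iff_dvd_coeff]
    intro j
    have := congrArg (fun f => (f.coeff i).coeff j) hP
    simpa [ZMod.intCast_zmod_eq_zero_iff_dvd] using (ZMod.intCast_zmod_eq_zero_iff_dvd _ 2).1
      (by simpa using this)
  obtain ⟨Q, rfl⟩ := h
  exact ⟨Q, by simp only [map_ofNat]⟩

end ModTwo

section Projective

variable {R K : Type*} [CommRing R] [Field K] [Algebra R K]

/-- The matrix `X` is a scalar multiple of the image of `N`. -/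
def IsMultipleOf (X : Matrix (Fin 2) (Fin 2) K) (N : Matrix (Fin 2) (Fin 2) R) : Prop :=
  ∃ κ : K, X = κ • N.map (algebraMap R K)

lemma isMultipleOf_of_eq_map {X : Matrix (Fin 2) (Fin 2) K} {N : Matrix (Fin 2) (Fin 2) R}
    (h : X = N.map (algebraMap R K)) : IsMultipleOf X N := ⟨1, by rw [one_smul, h]⟩

lemma IsMultipleOf.mul {X Y : Matrix (Fin 2) (Fin 2) K} {N N' : Matrix (Fin 2) (Fin 2) R}
    (hX : IsMultipleOf X N) (hY : IsMultipleOf Y N') : IsMultipleOf (X * Y) (N * N') := by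
  obtain ⟨κ, rfl⟩ := hX
  obtain ⟨μ, rfl⟩ := hY
  exact ⟨κ * μ, by rw [Matrix.map_mul, Matrix.smul_mul, Matrix.mul_smul, smul_smul]⟩

lemma IsMultipleOf.inv {X : (Matrix (Fin 2) (Fin 2) K)ˣ} {N : Matrix (Fin 2) (Fin 2) R}
    (hX : IsMultipleOf (X : Matrix (Fin 2) (Fin 2) K) N) :
    IsMultipleOf (X⁻¹ : (Matrix (Fin 2) (Fin 2) K)ˣ).val N.adjugate := by
  obtain ⟨κ, hκ⟩ := hX
  refine ⟨Ring.inverse (X : Matrix (Fin 2) (Fin 2) K).det * κ, ?_⟩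
  rw [Matrix.coe_units_inv, Matrix.inv_def, mul_smul, ← RingHom.mapMatrix_apply,
    RingHom.map_adjugate]
  congr 1
  rw [hκ, adjugate_smul]
  simp

end Projective

section Generic

/-- The specialisation `x = 0` from `𝔽₂[x][y]` to `𝔽₂[y]`. -/
noncomputable def evalZero : (ZMod 2)[X][X] →+* (ZMod 2)[X] := mapRingHom (evalRingHom 0)

lemma evalZero_X : evalZero X = X := by simp [evalZero]

lemma evalZero_C_X : evalZero (C X) = 0 := by simp [evalZero]

lemma two_eq_zero_zmodTwo : (2 : (ZMod 2)[X]) = 0 := by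
  have h : (2 : ZMod 2) = 0 := rfl
  rw [show (2 : (ZMod 2)[X]) = C 2 from (by simp only [map_ofNat]), h, C_0]

variable {K : Type*} [Field K] [Algebra (ZMod 2)[X][X] K]

lemma isFreePair_of_map_evalZero
    (hinj : Function.Injective (algebraMap (ZMod 2)[X][X] K))
    {U V : (Matrix (Fin 2) (Fin 2) K)ˣ} {N N' : Matrix (Fin 2) (Fin 2) (ZMod 2)[X][X]}
    (hU : IsMultipleOf U.val N) (hV : IsMultipleOf V.val N')
    (hN : N.map evalZero = !![0, 0; 0, 1]) {κ : (ZMod 2)[X]} (hκ : κ ≠ 0)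
    (hN' : N'.map evalZero =
      κ • !![X ^ 2 * (X ^ 2 + 1), X ^ 3; X * (X ^ 2 + 1), X ^ 2]) :
    IsFreePair U V := by
  have h2 := two_eq_zero_zmodTwo
  have hX : (X : (ZMod 2)[X]) ≠ 0 := X_ne_zero
  have hX2 : (X ^ 2 + 1 : (ZMod 2)[X]) ≠ 0 := X_pow_add_C_ne_zero two_pos 1
  have hX4 : ((X ^ 2 + 1) * X ^ 2 + X * X : (ZMod 2)[X]) ≠ 0 := by
    have : ((X ^ 2 + 1) * X ^ 2 + X * X : (ZMod 2)[X]) = X ^ 4 := by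
      linear_combination X ^ 2 * h2
    rw [this]
    exact pow_ne_zero 4 hX
  refine injective_lift_of_rank_one hinj evalZero _
    (fun l => match l with
      | (true, true) => N
      | (true, false) => N.adjugate
      | (false, true) => N'
      | (false, false) => N'.adjugate)
    (fun l => match l with
      | (true, true) => ![0, 1]
      | (true, false) => ![1, 0]
      | (false, true) => ![κ * X ^ 2, κ * X]
      | (false, false) => ![κ * X, κ * (X ^ 2 + 1)])
    (fun l => match l with
      | (true, true) => ![0, 1]
      | (true, false) => ![1, 0]
      | (false, true) => ![X ^ 2 + 1, X]
      | (false, false) => ![X, X ^ 2]) ?_ ?_ ?_ ?_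
  · rintro (_ | _)
    · exact hV
    · exact hU
  · rintro (_ | _)
    · exact hV.inv
    · exact hU.inv
  · rintro ⟨_ | _, _ | _⟩
    · change evalZero.mapMatrix _ = _
      rw [RingHom.map_adjugate, RingHom.mapMatrix_apply, hN', adjugate_fin_two]
      ext1 i j
      fin_cases i <;> fin_cases j <;> simp [vecMulVec_apply] <;> grind
    · change N'.map evalZero = _
      rw [hN']
      ext1 i j
      fin_cases i <;> fin_cases j <;> simp [vecMulVec_apply] <;> ring
    · change evalZero.mapMatrix _ = _
      rw [RingHom.map_adjugate, RingHom.mapMatrix_apply, hN, adjugate_fin_two]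
      ext1 i j
      fin_cases i <;> fin_cases j <;> simp [vecMulVec_apply]
    · change N.map evalZero = _
      rw [hN]
      ext1 i j
      fin_cases i <;> fin_cases j <;> simp [vecMulVec_apply]
  · have e1 : X * (κ * X) + X ^ 2 * (κ * (X ^ 2 + 1)) = κ * ((X ^ 2 + 1) * X ^ 2 + X * X) := by
      ring
    have e2 : (X ^ 2 + 1) * (κ * X ^ 2) + X * (κ * X) = κ * ((X ^ 2 + 1) * X ^ 2 + X * X) := by
      ring
    rintro ⟨_ | _, _ | _⟩ ⟨_ | _, _ | _⟩ h <;>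
      simp [dotProduct, Fin.sum_univ_two, e1, e2, hX, hX2, hX4, hκ] at h ⊢

end Generic

section Weyl

variable {D : Type*} [DivisionRing D] {s t : D}

lemma weyl_skew (hst : s * t - t * s = 1) : s * (t * s) = (t * s + 1) * s := by
  rw [← hst]
  noncomm_ring

lemma weyl_left_ne_zero (hst : s * t - t * s = 1) : s ≠ 0 := by
  rintro rfl
  simp at hst

/-- The fraction field `𝔽₂(x, y)`. -/
abbrev FracField : Type := FractionRing (ZMod 2)[X][X]

/-- The skew relation in the product of `D` with the matrix ring over `𝔽₂(x, y)`. -/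
lemma prod_skew (h : s * (t * s) = (t * s + 1) * s) :
    ((s, swapMat.map (algebraMap _ FracField)) : D × Matrix (Fin 2) (Fin 2) FracField) *
      (t * s, diagMat.map (algebraMap _ FracField)) =
    ((t * s, diagMat.map (algebraMap _ FracField)) + 1) *
      (s, swapMat.map (algebraMap _ FracField)) := by
  refine Prod.ext h ?_
  have := congrArg (algebraMap (ZMod 2)[X][X] FracField).mapMatrix swapMat_mul_diagMat
  rw [map_mul, map_mul, map_add, map_one] at this
  exact this

lemma snd_skewEval (P : ℤ[X][X]) :
    (skewEval ((t * s, diagMat.map (algebraMap _ FracField)) : D × _)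
      (s, swapMat.map (algebraMap _ FracField)) P).2 =
    (skewEval diagMat swapMat P).map (algebraMap _ FracField) :=
  (map_skewEval (RingHom.snd D (Matrix (Fin 2) (Fin 2) FracField)) P).trans
    (map_skewEval (x := diagMat) (y := swapMat)
      (algebraMap (ZMod 2)[X][X] FracField).mapMatrix P).symm

lemma fst_skewEval (P : ℤ[X][X]) :
    (skewEval ((t * s, diagMat.map (algebraMap _ FracField)) : D × _)
      (s, swapMat.map (algebraMap _ FracField)) P).1 = skewEval (t * s) s P :=
  map_skewEval (RingHom.fst D (Matrix (Fin 2) (Fin 2) FracField)) P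

lemma isUnit_map_of_det_ne_zero {N : Matrix (Fin 2) (Fin 2) (ZMod 2)[X][X]} (hN : N.det ≠ 0) :
    IsUnit (N.map (algebraMap _ FracField)) := by
  rw [Matrix.isUnit_iff_isUnit_det, ← RingHom.mapMatrix_apply, ← RingHom.map_det,
    isUnit_iff_ne_zero]
  exact (map_ne_zero_iff _ (IsFractionRing.injective _ _)).2 hN

variable [Algebra ℚ D]

lemma exists_mul_mul_pow_mem_skewSubring (h : s * (t * s) = (t * s + 1) * s) {a : D}
    (ha : a ∈ Algebra.adjoin ℚ ({s, t} : Set D)) :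
    ∃ m : ℤ, m ≠ 0 ∧ ∃ n : ℕ, (m : D) * a * s ^ n ∈ skewSubring h := by
  have hs := right_mem_skewSubring h
  induction ha using Algebra.adjoin_induction with
  | mem a ha =>
    rcases ha with rfl | rfl
    · exact ⟨1, one_ne_zero, 0, by simpa using hs⟩
    · exact ⟨1, one_ne_zero, 1, by simpa using left_mem_skewSubring h⟩
  | algebraMap q =>
    refine ⟨q.den, by exact_mod_cast q.den_ne_zero, 0, ?_⟩
    have : ((q.den : ℤ) : D) * algebraMap ℚ D q = ((q.num : ℤ) : D) := by
      rw [← map_intCast (algebraMap ℚ D) (q.den : ℤ), ← map_mul]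
      rw [← map_intCast (algebraMap ℚ D) q.num]
      congr 1
      exact_mod_cast Rat.den_mul_eq_num q
    rw [this, pow_zero, mul_one]
    exact intCast_mem _ _
  | add a b _ _ iha ihb =>
    obtain ⟨m, hm, n, ha⟩ := iha
    obtain ⟨m', hm', n', hb⟩ := ihb
    refine ⟨m * m', mul_ne_zero hm hm', n + n', ?_⟩
    have e : ((m * m' : ℤ) : D) * (a + b) * s ^ (n + n') =
        (m' : D) * (m * a * s ^ n) * s ^ n' + m * (m' * b * s ^ n') * s ^ n := by
      rw [mul_add, add_mul]
      congr 1
      · rw [pow_add, mul_comm m]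
        push_cast
        simp only [mul_assoc]
      · rw [add_comm n, pow_add]
        push_cast
        simp only [mul_assoc]
    rw [e]
    exact add_mem (mul_mem (mul_mem (intCast_mem _ _) ha) (pow_mem hs _))
      (mul_mem (mul_mem (intCast_mem _ _) hb) (pow_mem hs _))
  | mul a b _ _ iha ihb =>
    obtain ⟨m, hm, n, ha⟩ := iha
    obtain ⟨m', hm', n', hb⟩ := ihb
    obtain ⟨b', hb', e⟩ := exists_mul_pow_eq h hb n
    refine ⟨m * m', mul_ne_zero hm hm', n' + n, ?_⟩
    have : ((m * m' : ℤ) : D) * (a * b) * s ^ (n' + n) = m * a * s ^ n * b' := by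
      rw [mul_assoc _ (s ^ n), ← e, pow_add]
      push_cast
      have hc : a * (m' : D) = m' * a := (Int.cast_commute m' a).eq.symm
      calc (m : D) * m' * (a * b) * (s ^ n' * s ^ n)
          = m * (m' * a) * b * s ^ n' * s ^ n := by simp only [mul_assoc]
        _ = m * a * (m' * b * s ^ n' * s ^ n) := by rw [← hc]; simp only [mul_assoc]
    rw [this]
    exact mul_mem ha hb'

lemma exists_mul_skewEval_eq (h : s * (t * s) = (t * s + 1) * s) (hs : s ≠ 0)
    (hquot : ∀ d : D, ∃ a b : D, a ∈ Algebra.adjoin ℚ ({s, t} : Set D) ∧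
      b ∈ Algebra.adjoin ℚ ({s, t} : Set D) ∧ b ≠ 0 ∧ d = a * b⁻¹) (d : D) :
    ∃ T E : ℤ[X][X], T ≠ 0 ∧ d * skewEval (t * s) s T = skewEval (t * s) s E := by
  have : CharZero D := algebraRat.charZero D
  obtain ⟨a, b, ha, hb, hb0, rfl⟩ := hquot d
  obtain ⟨m, hm, n, ha⟩ := exists_mul_mul_pow_mem_skewSubring h ha
  obtain ⟨m', hm', n', hb⟩ := exists_mul_mul_pow_mem_skewSubring h hb
  have hsk := fun k => pow_mem (right_mem_skewSubring h) k
  obtain ⟨T, hT⟩ := mul_mem (mul_mem (intCast_mem (skewSubring h) m) hb) (hsk n)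
  obtain ⟨E, hE⟩ := mul_mem (mul_mem (intCast_mem (skewSubring h) m') ha) (hsk n')
  refine ⟨T, E, ?_, ?_⟩
  · rintro rfl
    have h0 : (m : D) * (m' * b * s ^ n') * s ^ n ≠ 0 := by
      simp [hm, hm', hb0, hs]
    exact h0 (by rw [← hT, map_zero])
  · rw [hT, hE]
    have e : (m : D) * (m' * b * s ^ n') * s ^ n = b * (((m * m' : ℤ) : D) * s ^ (n + n')) := by
      rw [← mul_assoc b, ← (Int.cast_commute (m * m') b).eq, add_comm, pow_add]
      push_cast
      simp only [mul_assoc]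
    have e' : (m' : D) * (m * a * s ^ n) * s ^ n' = a * (((m * m' : ℤ) : D) * s ^ (n + n')) := by
      rw [← mul_assoc a, ← (Int.cast_commute (m * m') a).eq, pow_add, mul_comm m]
      push_cast
      simp only [mul_assoc]
    rw [e, e', mul_assoc, inv_mul_cancel_left₀ hb0]

lemma eq_zero_of_fst_eq_zero (h : s * (t * s) = (t * s + 1) * s) (hs : s ≠ 0)
    {a : D × Matrix (Fin 2) (Fin 2) FracField} (ha : a ∈ skewSubring (prod_skew h))
    (h0 : a.1 = 0) : a = 0 := by
  obtain ⟨P, rfl⟩ := ha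
  rw [fst_skewEval] at h0
  rw [skewEval_injective hs h h0, map_zero]

lemma isUnit_of_isUnit_snd (h : s * (t * s) = (t * s + 1) * s) (hs : s ≠ 0)
    {a : D × Matrix (Fin 2) (Fin 2) FracField} (ha : a ∈ skewSubring (prod_skew h))
    (h2 : IsUnit a.2) : IsUnit a := by
  rw [Prod.isUnit_iff]
  refine ⟨isUnit_iff_ne_zero.2 fun h0 => ?_, h2⟩
  rw [eq_zero_of_fst_eq_zero h hs ha h0] at h2
  exact not_isUnit_zero h2

lemma exists_skewEval_cancel_two (h : s * (t * s) = (t * s + 1) * s) (hs : s ≠ 0)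
    {a b : D × Matrix (Fin 2) (Fin 2) FracField} (ha : a ∈ skewSubring (prod_skew h))
    (hb : b ∈ skewSubring (prod_skew h)) (hbu : IsUnit b) (T : ℤ[X][X]) (n : ℕ) (E : ℤ[X][X])
    (hTE : a.1 * skewEval (t * s) s (2 ^ n * T) = b.1 * skewEval (t * s) s E) :
    ∃ E', a.1 * skewEval (t * s) s T = b.1 * skewEval (t * s) s E' := by
  have : CharZero D := algebraRat.charZero D
  have hdouble : ∀ Q : ℤ[X][X], 2 * Q = Q + Q := two_mul
  induction n generalizing E with
  | zero => exact ⟨E, by simpa using hTE⟩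
  | succ n ih =>
    rw [pow_succ', mul_assoc] at hTE
    have hmem : ∀ P, skewEval (_ : D × _) _ P ∈ skewSubring (prod_skew h) := fun P => ⟨P, rfl⟩
    have hprod : a * skewEval ((t * s, diagMat.map (algebraMap _ FracField)) : D × _)
          (s, swapMat.map (algebraMap _ FracField)) (2 * (2 ^ n * T)) =
        b * skewEval ((t * s, diagMat.map (algebraMap _ FracField)) : D × _)
          (s, swapMat.map (algebraMap _ FracField)) E := by
      rw [← sub_eq_zero]
      refine eq_zero_of_fst_eq_zero h hs (sub_mem (mul_mem ha (hmem _)) (mul_mem hb (hmem _))) ?_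
      rw [Prod.fst_sub, Prod.fst_mul, Prod.fst_mul, fst_skewEval, fst_skewEval, hTE, sub_self]
    have hE : E.map (mapRingHom (Int.castRingHom (ZMod 2))) = 0 := by
      by_contra hne
      have hu := isUnit_map_of_det_ne_zero (det_skewEval_ne_zero hne)
      have h2 := congrArg Prod.snd hprod
      rw [Prod.snd_mul, Prod.snd_mul, snd_skewEval, snd_skewEval] at h2
      have h20 : skewEval diagMat swapMat (2 * (2 ^ n * T)) = 0 := by
        rw [hdouble, map_add]
        ext1 i j
        rw [Matrix.add_apply, ← two_mul, two_eq_zero_poly, zero_mul, Matrix.zero_apply]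
      rw [h20, Matrix.map_zero _ (map_zero _), mul_zero] at h2
      have hbu2 : IsUnit b.2 := (Prod.isUnit_iff.1 hbu).2
      exact not_isUnit_zero (h2 ▸ hbu2.mul hu)
    obtain ⟨E', rfl⟩ := exists_eq_two_mul hE
    refine ih E' ?_
    rw [hdouble, hdouble, map_add, map_add, ← two_mul, ← two_mul] at hTE
    have hc : ∀ c d : D, c * (2 * d) = 2 * (c * d) := fun c d => by noncomm_ring
    rw [hc, hc] at hTE
    exact mul_left_cancel₀ two_ne_zero hTE

lemma skewSubring_ore (h : s * (t * s) = (t * s + 1) * s) (hs : s ≠ 0)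
    (hquot : ∀ d : D, ∃ a b : D, a ∈ Algebra.adjoin ℚ ({s, t} : Set D) ∧
      b ∈ Algebra.adjoin ℚ ({s, t} : Set D) ∧ b ≠ 0 ∧ d = a * b⁻¹) :
    ∀ a ∈ skewSubring (prod_skew h), ∀ b ∈ skewSubring (prod_skew h), IsUnit b →
      ∃ c ∈ skewSubring (prod_skew h), IsUnit c ∧
        ∃ e ∈ skewSubring (prod_skew h), a * c = b * e := by
  intro a ha b hb hbu
  have hb1 : b.1 ≠ 0 := (Prod.isUnit_iff.1 hbu).1.ne_zero
  obtain ⟨T, E, hT, hTE⟩ := exists_mul_skewEval_eq h hs hquot (b.1⁻¹ * a.1)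
  have hfin : FiniteMultiplicity (2 : ℤ[X][X]) T := by
    refine FiniteMultiplicity.of_not_isUnit (fun hu => ?_) hT
    have := hu.map ((constantCoeff : ℤ[X] →+* ℤ).comp constantCoeff)
    rw [map_ofNat] at this
    exact absurd this (by decide)
  obtain ⟨T', hT', hndvd⟩ := hfin.exists_eq_pow_mul_and_not_dvd
  rw [hT', mul_assoc, inv_mul_eq_iff_eq_mul₀ hb1] at hTE
  obtain ⟨E', hE'⟩ := exists_skewEval_cancel_two h hs ha hb hbu T' _ E hTE
  have hT2 : T'.map (mapRingHom (Int.castRingHom (ZMod 2))) ≠ 0 := fun h0 =>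
    hndvd (Dvd.intro _ (exists_eq_two_mul h0).choose_spec.symm)
  have hmem : ∀ P, skewEval _ _ P ∈ skewSubring (prod_skew h) := fun P => ⟨P, rfl⟩
  refine ⟨_, hmem T', isUnit_of_isUnit_snd h hs (hmem T') ?_, _, hmem E', ?_⟩
  · rw [snd_skewEval]
    exact isUnit_map_of_det_ne_zero (det_skewEval_ne_zero hT2)
  · rw [← sub_eq_zero]
    refine eq_zero_of_fst_eq_zero h hs (sub_mem (mul_mem ha (hmem _)) (mul_mem hb (hmem _))) ?_
    rw [Prod.fst_sub, Prod.fst_mul, Prod.fst_mul, fst_skewEval, fst_skewEval, hE', sub_self]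

end Weyl

section Assembly

variable {D : Type*} [DivisionRing D] {s t : D}

/-- The subring of `D × M₂(𝔽₂[x][y])` generated by `(t * s, diagMat)` and `(s, swapMat)`. -/
noncomputable def integralSubring (h : s * (t * s) = (t * s + 1) * s) :
    Subring (D × Matrix (Fin 2) (Fin 2) (ZMod 2)[X][X]) :=
  (skewSubring (prod_skew h)).comap
    (RingHom.prodMap (RingHom.id D) (algebraMap _ FracField).mapMatrix)

lemma left_mem_integralSubring (h : s * (t * s) = (t * s + 1) * s) :
    (t * s, diagMat) ∈ integralSubring h := left_mem_skewSubring (prod_skew h)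

lemma right_mem_integralSubring (h : s * (t * s) = (t * s + 1) * s) :
    (s, swapMat) ∈ integralSubring h := right_mem_skewSubring (prod_skew h)

variable [Algebra ℚ D]

lemma exists_mem_fractionSubgroup (h : s * (t * s) = (t * s + 1) * s) (hs : s ≠ 0)
    (hquot : ∀ d : D, ∃ a b : D, a ∈ Algebra.adjoin ℚ ({s, t} : Set D) ∧
      b ∈ Algebra.adjoin ℚ ({s, t} : Set D) ∧ b ≠ 0 ∧ d = a * b⁻¹)
    {d : D} {N : Matrix (Fin 2) (Fin 2) (ZMod 2)[X][X]} (hmem : (d, N) ∈ integralSubring h)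
    (hN : N.det ≠ 0) :
    ∃ p ∈ fractionSubgroup _ (skewSubring_ore h hs hquot),
      (p : D × Matrix (Fin 2) (Fin 2) FracField).1 = d ∧
      (p : D × Matrix (Fin 2) (Fin 2) FracField).2 = N.map (algebraMap _ FracField) := by
  obtain ⟨p, hp⟩ := isUnit_of_isUnit_snd h hs hmem (isUnit_map_of_det_ne_zero hN)
  exact ⟨p, mem_fractionSubgroup _ (hp ▸ hmem), congrArg Prod.fst hp, congrArg Prod.snd hp⟩

lemma det_ne_zero_of_map_evalZero {N : Matrix (Fin 2) (Fin 2) (ZMod 2)[X][X]}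
    (hN : (N.map evalZero).det ≠ 0) : N.det ≠ 0 := by
  intro h0
  rw [← RingHom.mapMatrix_apply, ← RingHom.map_det, h0, map_zero] at hN
  exact hN rfl

lemma map_evalZero_diagMat : diagMat.map evalZero = !![0, 0; 0, 1] := by
  ext1 i j
  fin_cases i <;> fin_cases j <;> simp [diagMat, evalZero_C_X]

lemma map_evalZero_swapMat : swapMat.map evalZero = !![0, X; X, 0] := by
  ext1 i j
  fin_cases i <;> fin_cases j <;> simp [swapMat, evalZero_X]

lemma det_diagMat_ne_zero : diagMat.det ≠ 0 := by
  rw [diagMat, det_fin_two_of, mul_zero, sub_zero, ← C_1, ← C_add, ← C_mul]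
  exact C_ne_zero.2 (mul_ne_zero X_ne_zero (X_add_C_ne_zero 1))

lemma det_diagMat_add_one_ne_zero : (diagMat + 1).det ≠ 0 := by
  have : (diagMat + 1).det = diagMat.det := by
    simp only [diagMat, det_fin_two, Matrix.add_apply]
    simp
    linear_combination (C X + 1) * two_eq_zero_poly
  rw [this]
  exact det_diagMat_ne_zero

lemma det_swapMat_ne_zero : swapMat.det ≠ 0 := by
  simp [swapMat, det_fin_two_of]

/-- The matrix playing the role of `1 + s - t`, up to a scalar. -/
noncomputable def symmMat : Matrix (Fin 2) (Fin 2) (ZMod 2)[X][X] :=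
  swapMat + swapMat * swapMat - diagMat

lemma map_evalZero_symmMat : symmMat.map evalZero = !![X ^ 2, X; X, X ^ 2 + 1] := by
  have h2 := two_eq_zero_zmodTwo
  rw [symmMat, ← RingHom.mapMatrix_apply, map_sub, map_add, map_mul, RingHom.mapMatrix_apply,
    RingHom.mapMatrix_apply, map_evalZero_diagMat, map_evalZero_swapMat]
  ext1 i j
  fin_cases i <;> fin_cases j <;> simp <;> grind

lemma det_symmMat_ne_zero : symmMat.det ≠ 0 := by
  refine det_ne_zero_of_map_evalZero ?_
  have : (symmMat.map evalZero).det = X ^ 4 := by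
    rw [map_evalZero_symmMat, det_fin_two_of]
    ring
  rw [this]
  exact pow_ne_zero 4 X_ne_zero

lemma map_evalZero_diagMat_add_swapMat :
    (diagMat + swapMat).map evalZero = !![0, X; X, 1] := by
  rw [← RingHom.mapMatrix_apply, map_add, RingHom.mapMatrix_apply,
    RingHom.mapMatrix_apply, map_evalZero_diagMat, map_evalZero_swapMat]
  ext1 i j
  fin_cases i <;> fin_cases j <;> simp

lemma map_evalZero_diagMat_add_swapMat_add_one :
    (diagMat + swapMat + 1).map evalZero = !![1, X; X, 0] := by
  have h2 := two_eq_zero_zmodTwo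
  rw [← RingHom.mapMatrix_apply, map_add, RingHom.mapMatrix_apply,
    map_evalZero_diagMat_add_swapMat, map_one]
  ext1 i j
  fin_cases i <;> fin_cases j <;> simp
  linear_combination h2

lemma det_diagMat_add_swapMat_ne_zero : (diagMat + swapMat).det ≠ 0 := by
  refine det_ne_zero_of_map_evalZero ?_
  rw [map_evalZero_diagMat_add_swapMat, det_fin_two_of]
  simp

lemma det_diagMat_add_swapMat_add_one_ne_zero : (diagMat + swapMat + 1).det ≠ 0 := by
  refine det_ne_zero_of_map_evalZero ?_
  rw [map_evalZero_diagMat_add_swapMat_add_one, det_fin_two_of]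
  simp

lemma map_evalZero_diagMat_mul_adjugate :
    (diagMat * (diagMat + 1).adjugate).map evalZero = !![0, 0; 0, 1] := by
  rw [← RingHom.mapMatrix_apply, map_mul, RingHom.map_adjugate, map_add, map_one,
    RingHom.mapMatrix_apply, map_evalZero_diagMat, adjugate_fin_two]
  ext1 i j
  fin_cases i <;> fin_cases j <;> simp [Matrix.mul_apply, Fin.sum_univ_two]

lemma isFreePair_fst (h : s * (t * s) = (t * s + 1) * s) (hs : s ≠ 0)
    (hquot : ∀ d : D, ∃ a b : D, a ∈ Algebra.adjoin ℚ ({s, t} : Set D) ∧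
      b ∈ Algebra.adjoin ℚ ({s, t} : Set D) ∧ b ≠ 0 ∧ d = a * b⁻¹)
    {p q : (D × Matrix (Fin 2) (Fin 2) FracField)ˣ}
    (hp : p ∈ fractionSubgroup _ (skewSubring_ore h hs hquot))
    (hq : q ∈ fractionSubgroup _ (skewSubring_ore h hs hquot))
    {N N' : Matrix (Fin 2) (Fin 2) (ZMod 2)[X][X]}
    (hpN : IsMultipleOf (Units.map (RingHom.snd D (Matrix (Fin 2) (Fin 2) FracField) :
      D × Matrix (Fin 2) (Fin 2) FracField →* Matrix (Fin 2) (Fin 2) FracField) p).val N)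
    (hqN : IsMultipleOf (Units.map (RingHom.snd D (Matrix (Fin 2) (Fin 2) FracField) :
      D × Matrix (Fin 2) (Fin 2) FracField →* Matrix (Fin 2) (Fin 2) FracField) q).val N')
    (hN : N.map evalZero = !![0, 0; 0, 1]) {κ : (ZMod 2)[X]} (hκ : κ ≠ 0)
    (hN' : N'.map evalZero =
      κ • !![X ^ 2 * (X ^ 2 + 1), X ^ 3; X * (X ^ 2 + 1), X ^ 2]) :
    IsFreePair
      (Units.map (RingHom.fst D (Matrix (Fin 2) (Fin 2) FracField) :
        D × Matrix (Fin 2) (Fin 2) FracField →* D) p)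
      (Units.map (RingHom.fst D (Matrix (Fin 2) (Fin 2) FracField) :
        D × Matrix (Fin 2) (Fin 2) FracField →* D) q) :=
  isFreePair_fst_of_snd (skewSubring_ore h hs hquot)
    (fun _ ha h0 => by rw [eq_zero_of_fst_eq_zero h hs ha h0, Prod.snd_zero]) hp hq
    (isFreePair_of_map_evalZero (IsFractionRing.injective _ _) hpN hqN hN hκ hN')

lemma exists_isFreePair_symmetric (hst : s * t - t * s = 1)
    (hquot : ∀ d : D, ∃ a b : D, a ∈ Algebra.adjoin ℚ ({s, t} : Set D) ∧
      b ∈ Algebra.adjoin ℚ ({s, t} : Set D) ∧ b ≠ 0 ∧ d = a * b⁻¹) :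
    ∃ u g : Dˣ, (u : D) = t * s * (t * s + 1)⁻¹ ∧ (g : D) = 1 + s - t ∧
      IsFreePair u (g * u * g) := by
  have h := weyl_skew hst
  have hs := weyl_left_ne_zero hst
  have hx := left_mem_integralSubring h
  have hy := right_mem_integralSubring h
  obtain ⟨x, hxm, hx1, hx2⟩ := exists_mem_fractionSubgroup h hs hquot hx det_diagMat_ne_zero
  obtain ⟨x', hxm', hx1', hx2'⟩ := exists_mem_fractionSubgroup h hs hquot
    (d := t * s + 1) (N := diagMat + 1) (add_mem hx (one_mem _)) det_diagMat_add_one_ne_zero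
  obtain ⟨y, hym, hy1, hy2⟩ := exists_mem_fractionSubgroup h hs hquot hy det_swapMat_ne_zero
  obtain ⟨w, hwm, hw1, hw2⟩ := exists_mem_fractionSubgroup h hs hquot
    (d := s + s * s - t * s) (N := symmMat)
    (sub_mem (add_mem hy (mul_mem hy hy)) hx) det_symmMat_ne_zero
  set f := Units.map (RingHom.fst D (Matrix (Fin 2) (Fin 2) FracField) :
        D × Matrix (Fin 2) (Fin 2) FracField →* D)
  set f' := Units.map (RingHom.snd D (Matrix (Fin 2) (Fin 2) FracField) :
    D × Matrix (Fin 2) (Fin 2) FracField →* Matrix (Fin 2) (Fin 2) FracField)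
  have hpm := mul_mem hxm (inv_mem hxm')
  have hgm := mul_mem hwm (inv_mem hym)
  refine ⟨f (x * x'⁻¹), f (w * y⁻¹), ?_, ?_, ?_⟩
  · rw [map_mul, map_inv, Units.val_mul, Units.val_inv_eq_inv_val]
    exact congrArg₂ (fun a b => a * b⁻¹) hx1 hx1'
  · rw [map_mul, map_inv, Units.val_mul, Units.val_inv_eq_inv_val]
    refine (congrArg₂ (fun a b => a * b⁻¹) hw1 hy1).trans ?_
    rw [show s + s * s - t * s = (1 + s - t) * s by noncomm_ring, mul_inv_cancel_right₀ hs]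
  · rw [← map_mul, ← map_mul]
    have hp : IsMultipleOf (f' (x * x'⁻¹)).val (diagMat * (diagMat + 1).adjugate) := by
      rw [map_mul, map_inv, Units.val_mul]
      exact (isMultipleOf_of_eq_map hx2).mul (isMultipleOf_of_eq_map hx2').inv
    have hg : IsMultipleOf (f' (w * y⁻¹)).val (symmMat * swapMat.adjugate) := by
      rw [map_mul, map_inv, Units.val_mul]
      exact (isMultipleOf_of_eq_map hw2).mul (isMultipleOf_of_eq_map hy2).inv
    refine isFreePair_fst h hs hquot hpm (mul_mem (mul_mem hgm hpm) hgm) hp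
      (N' := symmMat * swapMat.adjugate * (diagMat * (diagMat + 1).adjugate) *
        (symmMat * swapMat.adjugate)) ?_ map_evalZero_diagMat_mul_adjugate
      (κ := X ^ 2) (pow_ne_zero 2 X_ne_zero) ?_
    · rw [map_mul, map_mul, Units.val_mul, Units.val_mul]
      exact (hg.mul hp).mul hg
    · have h2 := two_eq_zero_zmodTwo
      rw [← RingHom.mapMatrix_apply, map_mul, map_mul, RingHom.mapMatrix_apply _
        (diagMat * _), map_evalZero_diagMat_mul_adjugate, map_mul, RingHom.map_adjugate,
        RingHom.mapMatrix_apply, RingHom.mapMatrix_apply, map_evalZero_symmMat,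
        map_evalZero_swapMat, adjugate_fin_two]
      ext1 i j
      fin_cases i <;> fin_cases j <;> simp [Matrix.mul_apply, Fin.sum_univ_two] <;> grind

lemma exists_isFreePair_unitary (hst : s * t - t * s = 1)
    (hquot : ∀ d : D, ∃ a b : D, a ∈ Algebra.adjoin ℚ ({s, t} : Set D) ∧
      b ∈ Algebra.adjoin ℚ ({s, t} : Set D) ∧ b ≠ 0 ∧ d = a * b⁻¹) :
    ∃ u x y : Dˣ, (u : D) = t * s * (t * s + 1)⁻¹ ∧ (x : D) = t * s + s ∧
      (y : D) = t * s + s + 1 ∧ IsFreePair u (x * y⁻¹ * u⁻¹ * (x * y⁻¹)⁻¹) := by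
  have h := weyl_skew hst
  have hs := weyl_left_ne_zero hst
  have hx := left_mem_integralSubring h
  have hy := right_mem_integralSubring h
  obtain ⟨x, hxm, hx1, hx2⟩ := exists_mem_fractionSubgroup h hs hquot hx det_diagMat_ne_zero
  obtain ⟨x', hxm', hx1', hx2'⟩ := exists_mem_fractionSubgroup h hs hquot
    (d := t * s + 1) (N := diagMat + 1) (add_mem hx (one_mem _)) det_diagMat_add_one_ne_zero
  obtain ⟨w, hwm, hw1, hw2⟩ := exists_mem_fractionSubgroup h hs hquot
    (d := t * s + s) (N := diagMat + swapMat) (add_mem hx hy) det_diagMat_add_swapMat_ne_zero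
  obtain ⟨w', hwm', hw1', hw2'⟩ := exists_mem_fractionSubgroup h hs hquot
    (d := t * s + s + 1) (N := diagMat + swapMat + 1)
    (add_mem (add_mem hx hy) (one_mem _)) det_diagMat_add_swapMat_add_one_ne_zero
  set f := Units.map (RingHom.fst D (Matrix (Fin 2) (Fin 2) FracField) :
        D × Matrix (Fin 2) (Fin 2) FracField →* D)
  set f' := Units.map (RingHom.snd D (Matrix (Fin 2) (Fin 2) FracField) :
    D × Matrix (Fin 2) (Fin 2) FracField →* Matrix (Fin 2) (Fin 2) FracField)
  have hpm := mul_mem hxm (inv_mem hxm')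
  have hgm := mul_mem hwm (inv_mem hwm')
  refine ⟨f (x * x'⁻¹), f w, f w', ?_, hw1, hw1', ?_⟩
  · rw [map_mul, map_inv, Units.val_mul, Units.val_inv_eq_inv_val]
    exact congrArg₂ (fun a b => a * b⁻¹) hx1 hx1'
  · rw [← map_inv, ← map_inv, ← map_mul f w, ← map_inv, ← map_mul, ← map_mul]
    have hp : IsMultipleOf (f' (x * x'⁻¹)).val (diagMat * (diagMat + 1).adjugate) := by
      rw [map_mul, map_inv, Units.val_mul]
      exact (isMultipleOf_of_eq_map hx2).mul (isMultipleOf_of_eq_map hx2').inv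
    have hg : IsMultipleOf (f' (w * w'⁻¹)).val
        ((diagMat + swapMat) * (diagMat + swapMat + 1).adjugate) := by
      rw [map_mul, map_inv, Units.val_mul]
      exact (isMultipleOf_of_eq_map hw2).mul (isMultipleOf_of_eq_map hw2').inv
    refine isFreePair_fst h hs hquot hpm (mul_mem (mul_mem hgm (inv_mem hpm)) (inv_mem hgm)) hp
      (N' := (diagMat + swapMat) * (diagMat + swapMat + 1).adjugate *
        (diagMat * (diagMat + 1).adjugate).adjugate *
        ((diagMat + swapMat) * (diagMat + swapMat + 1).adjugate).adjugate) ?_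
      map_evalZero_diagMat_mul_adjugate (κ := 1) one_ne_zero ?_
    · rw [map_mul, map_mul, map_inv, map_inv, Units.val_mul, Units.val_mul]
      exact (hg.mul hp.inv).mul hg.inv
    · have h2 := two_eq_zero_zmodTwo
      rw [← RingHom.mapMatrix_apply, map_mul, map_mul, RingHom.map_adjugate,
        RingHom.map_adjugate, RingHom.mapMatrix_apply _ (diagMat * _),
        map_evalZero_diagMat_mul_adjugate, map_mul, RingHom.map_adjugate,
        RingHom.mapMatrix_apply, RingHom.mapMatrix_apply, map_evalZero_diagMat_add_swapMat,
        map_evalZero_diagMat_add_swapMat_add_one, adjugate_fin_two, adjugate_fin_two,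
        adjugate_fin_two]
      ext1 i j
      fin_cases i <;> fin_cases j <;> simp [Matrix.mul_apply, Fin.sum_univ_two] <;> grind

end Assembly

section AntiAutomorphism

variable {D : Type*} [DivisionRing D] {F : D → D}

lemma map_one_of_mul_rev (hmul : ∀ c d : D, F (c * d) = F d * F c) (hinv : ∀ c, F (F c) = c) :
    F 1 = 1 := by
  have := hmul (F 1) 1
  rwa [mul_one, hinv, mul_one, eq_comm] at this

lemma map_inv_of_mul_rev (hmul : ∀ c d : D, F (c * d) = F d * F c) (hinv : ∀ c, F (F c) = c)
    {c : D} (hc : c ≠ 0) : F c⁻¹ = (F c)⁻¹ := by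
  refine eq_inv_of_mul_eq_one_left ?_
  rw [← hmul, mul_inv_cancel₀ hc, map_one_of_mul_rev hmul hinv]

end AntiAutomorphism

end Helpers

theorem free_pairs_weyl_negated_involutions
    (D : Type*) [DivisionRing D] [Algebra ℚ D]
    (s t : D) (hst : s * t - t * s = 1)
    (hquot : ∀ d : D, ∃ a b : D, a ∈ Algebra.adjoin ℚ ({s, t} : Set D) ∧
      b ∈ Algebra.adjoin ℚ ({s, t} : Set D) ∧ b ≠ 0 ∧ d = a * b⁻¹) :
    (∀ invol : D →ₗ[ℚ] D,
      (∀ c d : D, invol (c * d) = invol d * invol c) →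
      (∀ c : D, invol (invol c) = c) →
      invol s = -t → invol t = -s →
      ∃ u v : Dˣ, IsFreePair u v ∧ invol (u : D) = (u : D) ∧ invol (v : D) = (v : D)) ∧
    (∀ invol : D →ₗ[ℚ] D,
      (∀ c d : D, invol (c * d) = invol d * invol c) →
      (∀ c : D, invol (invol c) = c) →
      invol s = -s → invol t = t →
      ∃ u v : Dˣ, IsFreePair u v ∧ (u : D) * invol (u : D) = 1 ∧ (v : D) * invol (v : D) = 1) := by
  have hst' : s * t = t * s + 1 := by rw [← hst, add_sub_cancel]
  constructor
  · intro invol hmul hinv his hit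
    obtain ⟨u, g, hu, hg, hfree⟩ := exists_isFreePair_symmetric hst hquot
    have h1 := map_one_of_mul_rev hmul hinv
    have hx' : t * s + 1 ≠ 0 := fun h0 => u.ne_zero (by rw [hu, h0, inv_zero, mul_zero])
    have hts : invol (t * s) = t * s := by rw [hmul, his, hit, neg_mul_neg]
    have hu' : invol u = u := by
      rw [hu, hmul, map_inv_of_mul_rev hmul hinv hx', map_add, h1, hts]
      exact ((Commute.refl (t * s)).add_right (Commute.one_right _)).inv_right₀.eq.symm
    have hg' : invol g = g := by
      rw [hg, map_sub, map_add, h1, his, hit]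
      abel
    refine ⟨u, g * u * g, hfree, hu', ?_⟩
    rw [Units.val_mul, Units.val_mul, hmul, hmul, hu', hg', mul_assoc]
  · intro invol hmul hinv his hit
    obtain ⟨u, x, y, hu, hx, hy, hfree⟩ := exists_isFreePair_unitary hst hquot
    have h1 := map_one_of_mul_rev hmul hinv
    have hx' : t * s + 1 ≠ 0 := fun h0 => u.ne_zero (by rw [hu, h0, inv_zero, mul_zero])
    have hts : invol (t * s) = -(t * s + 1) := by rw [hmul, his, hit, neg_mul, hst']
    have hneg : -(t * s + 1) + 1 = -(t * s) := by abel
    have hu' : invol u = (u⁻¹ : Dˣ) := by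
      rw [Units.val_inv_eq_inv_val, hu, hmul, map_inv_of_mul_rev hmul hinv hx', map_add, h1, hts,
        mul_inv_rev, inv_inv, hneg, inv_neg, neg_mul_neg]
      exact ((Commute.refl (t * s)).add_left (Commute.one_left _)).symm.inv_left₀.eq
    have hxi : invol x = -y := by
      rw [hx, hy, map_add, hts, his]
      abel
    have hyi : invol y = -x := by
      rw [hx, hy, map_add, map_add, hts, his, h1]
      abel
    have hxy : Commute x y := Units.ext (by
      rw [Units.val_mul, Units.val_mul, hy, hx]
      exact (Commute.refl (t * s + s)).add_right (Commute.one_right _))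
    have hg : invol (x * y⁻¹ : Dˣ) = ((x * y⁻¹)⁻¹ : Dˣ) := by
      rw [Units.val_mul, hmul, Units.val_inv_eq_inv_val, map_inv_of_mul_rev hmul hinv y.ne_zero,
        hxi, hyi, inv_neg, neg_mul_neg, ← Units.val_inv_eq_inv_val, ← Units.val_mul, mul_inv_rev,
        inv_inv, hxy.symm.inv_right.eq]
    have hinvol : ∀ v : Dˣ, invol (v⁻¹ : Dˣ) = (invol v)⁻¹ := fun v => by
      rw [Units.val_inv_eq_inv_val, map_inv_of_mul_rev hmul hinv v.ne_zero]
    refine ⟨u, x * y⁻¹ * u⁻¹ * (x * y⁻¹)⁻¹, hfree, ?_, ?_⟩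
    · rw [hu', Units.mul_inv]
    · set g := x * y⁻¹
      rw [Units.val_mul (g * u⁻¹), Units.val_mul g, hmul, hmul, hinvol, hinvol, hg, hu']
      simp [mul_assoc]
end

section
/- Let K be the field of rational functions in a, b over 𝔽₃ and let L be a field extension of K containing an element i with i³ − i = a. In L, the elements 1 + i², 1 + (i+1)², and 1 + (i+2)² are all nonzero. Let W be the 3×3 matrix over L with rows (0, 2i, b⁻¹(i+1)²), (i², 0, 2i+1), (2b(i+1), (i+2)², 0), let U be the diagonal 3×3 matrix with diagonal entries (1+i²)·(1+(i+1)²)⁻¹, (1+(i+2)²)·(1+i²)⁻¹, (1+(i+1)²)·(1+(i+2)²)⁻¹, and let I be the identity matrix. Then I − W and I + W are invertible, and, setting V = (I + W)·(I − W)⁻¹, the matrices U and V⁻¹UV form a free pair in GL(3, L). -/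
/-- The field of rational functions in two indeterminates `a`, `b` over `𝔽₃`. -/
abbrev Kfield : Type := FractionRing (MvPolynomial (Fin 2) (ZMod 3))

/-- The indeterminate `a` of `Kfield`. -/
noncomputable def aK : Kfield :=
  algebraMap (MvPolynomial (Fin 2) (ZMod 3)) Kfield (MvPolynomial.X 0)

/-- The indeterminate `b` of `Kfield`. -/
noncomputable def bK : Kfield :=
  algebraMap (MvPolynomial (Fin 2) (ZMod 3)) Kfield (MvPolynomial.X 1)

/-- A ring homomorphism out of a domain is injective as soon as its precomposition with an
integral homomorphism is. -/
theorem injective_of_injective_comp_isIntegral {A B C : Type*} [CommRing A] [CommRing B]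
    [IsDomain B] [CommRing C] [IsDomain C] (θ : A →+* B) (φ : B →+* C)
    (hθ : θ.IsIntegral) (h : Function.Injective (φ.comp θ)) : Function.Injective φ := by
  let _ := θ.toAlgebra
  have : Algebra.IsIntegral A B := ⟨hθ⟩
  have : Nontrivial A := θ.domain_nontrivial
  rw [RingHom.injective_iff_ker_eq_bot] at h ⊢
  apply Ideal.eq_bot_of_comap_eq_bot (R := A)
  rw [← h, ← RingHom.comap_ker]
  rfl

/-- The endomorphism of `k[x, y]` given by `x ↦ x ^ 3 - x` and `y ↦ y`. -/
noncomputable def artinSchreier :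
    MvPolynomial (Fin 2) (ZMod 3) →+* MvPolynomial (Fin 2) (ZMod 3) :=
  MvPolynomial.eval₂Hom MvPolynomial.C
    ![MvPolynomial.X 0 ^ 3 - MvPolynomial.X 0, MvPolynomial.X 1]

theorem artinSchreier_isIntegral : artinSchreier.IsIntegral := by
  intro p
  induction p using MvPolynomial.induction_on with
  | C r =>
    have : MvPolynomial.C r = artinSchreier (MvPolynomial.C r) := by simp [artinSchreier]
    rw [this]
    exact artinSchreier.isIntegralElem_map
  | add p q hp hq => exact hp.add _ hq
  | mul_X p j hp =>
    refine hp.mul _ ?_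
    fin_cases j
    · refine ⟨Polynomial.X ^ 3 - (Polynomial.X + Polynomial.C (MvPolynomial.X 0)), ?_, ?_⟩
      · apply Polynomial.monic_X_pow_sub
        compute_degree
        norm_num
      · simp [artinSchreier]
    · have : MvPolynomial.X 1 = artinSchreier (MvPolynomial.X 1) := by simp [artinSchreier]
      simp only [Fin.mk_one]
      rw [this]
      exact artinSchreier.isIntegralElem_map

/-- If `i ^ 3 - i = a`, then `i` and `b` are algebraically independent over `𝔽₃`. -/
theorem exists_injective_eval (L : Type*) [Field L] [Algebra Kfield L] (i : L)
    (hi : i ^ 3 - i = algebraMap Kfield L aK) :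
    ∃ φ : MvPolynomial (Fin 2) (ZMod 3) →+* L, Function.Injective φ ∧
      φ (MvPolynomial.X 0) = i ∧ φ (MvPolynomial.X 1) = algebraMap Kfield L bK := by
  let ι := (algebraMap Kfield L).comp (algebraMap (MvPolynomial (Fin 2) (ZMod 3)) Kfield)
  refine ⟨MvPolynomial.eval₂Hom (ι.comp MvPolynomial.C)
    ![i, algebraMap Kfield L bK], ?_, by simp, by simp⟩
  apply injective_of_injective_comp_isIntegral artinSchreier _ artinSchreier_isIntegral
  have : (MvPolynomial.eval₂Hom (ι.comp MvPolynomial.C)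
      ![i, algebraMap Kfield L bK]).comp artinSchreier = ι := by
    apply MvPolynomial.ringHom_ext
    · intro r
      simp only [artinSchreier, RingHom.comp_apply, MvPolynomial.eval₂Hom_C]
    · intro j
      fin_cases j
      · simpa [artinSchreier, aK, ι] using hi
      · simp [artinSchreier, bK, ι]
  rw [this]
  exact (algebraMap Kfield L).injective.comp (IsFractionRing.injective _ _)

section RankOne

open Matrix

variable {n F : Type*} [DecidableEq n] [Field F]

/-- A product of rank one matrices is a nonzero multiple of a rank one matrix, provided
consecutive factors pair nontrivially. -/
theorem exists_prod_vecMulVec [Fintype n] {ι : Type*} (x y : ι → n → F) (r : ι → ι → Prop)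
    (hr : ∀ l m, r l m → y l ⬝ᵥ x m ≠ 0) (l : ι) (t : List ι) (h : (l :: t).IsChain r) :
    ∃ d : F, d ≠ 0 ∧ ∃ m,
      ((l :: t).map fun k => vecMulVec (x k) (y k)).prod = d • vecMulVec (x l) (y m) := by
  induction t generalizing l with
  | nil => exact ⟨1, one_ne_zero, l, by simp⟩
  | cons k t ih =>
    rw [List.isChain_cons_cons] at h
    obtain ⟨d, hd, m, hm⟩ := ih k h.2
    refine ⟨d * (y l ⬝ᵥ x k), mul_ne_zero hd (hr _ _ h.1), m, ?_⟩
    rw [List.map_cons, List.prod_cons, hm, mul_smul_comm, vecMulVec_mul_vecMulVec,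
      vecMulVec_smul, smul_smul]

theorem vecMulVec_ne_smul_one [Nontrivial n] {x y : n → F} (hx : x ≠ 0) (hy : y ≠ 0) (s : F) :
    vecMulVec x y ≠ s • (1 : Matrix n n F) := by
  intro h
  obtain ⟨j, hj⟩ := Function.ne_iff.mp hx
  have hoff : ∀ k, k ≠ j → y k = 0 := fun k hk => by
    have := congrFun (congrFun h j) k
    rw [vecMulVec_apply, Matrix.smul_apply, one_apply_ne hk.symm, smul_zero] at this
    exact (mul_eq_zero.mp this).resolve_left hj
  obtain ⟨k, hk⟩ := exists_ne j
  have h1 : s = 0 := by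
    have := congrFun (congrFun h k) k
    simpa [vecMulVec_apply, hoff k hk, eq_comm] using this
  apply hy
  funext m
  have := congrFun (congrFun h j) m
  rw [vecMulVec_apply, Matrix.smul_apply, h1, zero_smul] at this
  exact (mul_eq_zero.mp this).resolve_left hj

/-- A freeness criterion: matrices over `L` generate a free group if they and their inverses,
up to scalars, lift to a subring `A` of `L` and reduce to rank one matrices over a field `F`
whose images avoid the kernels of all letters except their inverses. -/
theorem lift_injective_of_rank_one_reduction [Fintype n] [Nontrivial n] {α A L : Type*} [CommRing A]
    [Field L] (φ : A →+* L) (hφ : Function.Injective φ) (ψ : A →+* F) (g : α → GL n L)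
    (X : α × Bool → Matrix n n A) (c : α × Bool → L) (x y : α × Bool → n → F)
    (hX : ∀ l, φ.mapMatrix (X l) =
      c l • ((bif l.2 then g l.1 else (g l.1)⁻¹ : GL n L) : Matrix n n L))
    (hψ : ∀ l, ψ.mapMatrix (X l) = vecMulVec (x l) (y l))
    (hxy : ∀ l m : α × Bool, (l.1 = m.1 → l.2 = m.2) → y l ⬝ᵥ x m ≠ 0) :
    Function.Injective (FreeGroup.lift g) := by
  classical
  rw [injective_iff_map_eq_one]
  intro w hw
  by_contra hne
  have hred : FreeGroup.IsReduced w.toWord := FreeGroup.isReduced_toWord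
  rw [← FreeGroup.mk_toWord (x := w), FreeGroup.lift_mk] at hw
  rw [← FreeGroup.toWord_eq_nil_iff] at hne
  generalize w.toWord = t at *
  have hL : φ.mapMatrix (t.map X).prod = (t.map c).prod •
      (((t.map fun l => bif l.2 then g l.1 else (g l.1)⁻¹).prod : GL n L) : Matrix n n L) := by
    clear hw hred hne
    induction t with
    | nil => simp
    | cons l t ih =>
      simp only [List.map_cons, List.prod_cons, map_mul, hX, ih, Units.val_mul,
        smul_mul_smul_comm]
  rw [hw, Units.val_one] at hL
  obtain ⟨l, t, rfl⟩ := List.exists_cons_of_ne_nil hne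
  obtain ⟨d, hd, m, hm⟩ := exists_prod_vecMulVec x y _ hxy l t hred
  have hF : ψ.mapMatrix ((l :: t).map X).prod = d • vecMulVec (x l) (y m) := by
    rw [← hm, map_list_prod, List.map_map]
    congr 1
    exact List.map_congr_left fun k _ => hψ k
  generalize ((l :: t).map X).prod = Y at hL hF
  have hne : ∀ l, y l ≠ 0 ∧ x l ≠ 0 := fun l => by
    have := hxy l l fun _ => rfl
    refine ⟨?_, ?_⟩ <;> intro h0 <;> simp [h0] at this
  obtain ⟨j⟩ : Nonempty n := inferInstance
  have hY : Y = Y j j • (1 : Matrix n n A) := by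
    ext p q
    apply hφ
    have h1 := congrFun (congrFun hL p) q
    have h2 := congrFun (congrFun hL j) j
    simp only [RingHom.mapMatrix_apply, map_apply, Matrix.smul_apply, smul_eq_mul, one_apply_eq,
      mul_one] at h1 h2 ⊢
    rw [map_mul, h1, h2, one_apply, one_apply, apply_ite φ, map_one, map_zero]
  refine vecMulVec_ne_smul_one (smul_ne_zero hd (hne l).2) (hne m).1 (ψ (Y j j)) ?_
  rw [smul_vecMulVec, ← hF]
  conv_lhs => rw [hY]
  ext p q
  simp [one_apply, apply_ite ψ]

end RankOne

section Matrices

open Matrix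

variable {R S : Type*} [CommRing R] [CommRing S]

/-- The matrix `b (1 + W)`. -/
def cayleyNum (i b : R) : Matrix (Fin 3) (Fin 3) R :=
  !![b, 2 * i * b, (i + 1) ^ 2;
     i ^ 2 * b, b, (2 * i + 1) * b;
     2 * b ^ 2 * (i + 1), (i + 2) ^ 2 * b, b]

/-- The matrix `b (1 - W)`. -/
def cayleyDen (i b : R) : Matrix (Fin 3) (Fin 3) R :=
  !![b, -(2 * i * b), -(i + 1) ^ 2;
     -(i ^ 2 * b), b, -((2 * i + 1) * b);
     -(2 * b ^ 2 * (i + 1)), -((i + 2) ^ 2 * b), b]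

/-- The diagonal matrix `U` (for `true`) or its inverse (for `false`), multiplied by
`(1 + i ^ 2) (1 + (i + 1) ^ 2) (1 + (i + 2) ^ 2)`. -/
def diagNum (i : R) (e : Bool) : Matrix (Fin 3) (Fin 3) R :=
  diagonal (bif e then
    ![(1 + i ^ 2) ^ 2 * (1 + (i + 2) ^ 2), (1 + (i + 2) ^ 2) ^ 2 * (1 + (i + 1) ^ 2),
      (1 + (i + 1) ^ 2) ^ 2 * (1 + i ^ 2)]
  else
    ![(1 + (i + 1) ^ 2) ^ 2 * (1 + (i + 2) ^ 2), (1 + i ^ 2) ^ 2 * (1 + (i + 1) ^ 2),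
      (1 + (i + 2) ^ 2) ^ 2 * (1 + i ^ 2)])

/-- The left conjugating factor: trivial for the first generator, proportional to `V⁻¹`
for the second. -/
def conjLeft (i b : R) (g : Bool) : Matrix (Fin 3) (Fin 3) R :=
  bif g then 1 else cayleyDen i b * (cayleyNum i b).adjugate

/-- The right conjugating factor: trivial for the first generator, proportional to `V`
for the second. -/
def conjRight (i b : R) (g : Bool) : Matrix (Fin 3) (Fin 3) R :=
  bif g then 1 else cayleyNum i b * (cayleyDen i b).adjugate

theorem map_cayleyNum (f : R →+* S) (i b : R) :
    f.mapMatrix (cayleyNum i b) = cayleyNum (f i) (f b) := by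
  ext p q
  fin_cases p <;> fin_cases q <;> simp [map_ofNat f 2, cayleyNum]

theorem map_cayleyDen (f : R →+* S) (i b : R) :
    f.mapMatrix (cayleyDen i b) = cayleyDen (f i) (f b) := by
  ext p q
  fin_cases p <;> fin_cases q <;> simp [map_ofNat f 2, cayleyDen]

theorem map_diagNum (f : R →+* S) (i : R) (e : Bool) :
    f.mapMatrix (diagNum i e) = diagNum (f i) e := by
  ext p q
  cases e <;> fin_cases p <;> fin_cases q <;> simp [map_ofNat f 2, diagNum]

theorem map_conjLeft (f : R →+* S) (i b : R) (g : Bool) :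
    f.mapMatrix (conjLeft i b g) = conjLeft (f i) (f b) g := by
  cases g <;>
    simp only [conjLeft, cond_true, cond_false, map_one, map_mul, RingHom.map_adjugate,
      map_cayleyNum, map_cayleyDen]

theorem map_conjRight (f : R →+* S) (i b : R) (g : Bool) :
    f.mapMatrix (conjRight i b g) = conjRight (f i) (f b) g := by
  cases g <;>
    simp only [conjRight, cond_true, cond_false, map_one, map_mul, RingHom.map_adjugate,
      map_cayleyNum, map_cayleyDen]

end Matrices

section Reduction

open Matrix

/-- The field `𝔽₉ = 𝔽₃(ω)` with `ω ^ 2 = -1`. -/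
abbrev F9 : Type := QuadraticAlgebra (ZMod 3) (-1) 0

instance fact_neg_one_not_square : Fact (∀ r : ZMod 3, r ^ 2 ≠ -1 + 0 * r) := ⟨by decide⟩

/-- The class of `i` in `𝔽₉`. -/
def iF9 : F9 := ⟨0, 1⟩

/-- The value in `𝔽₉` at which `b` is specialized. -/
def bF9 : F9 := ⟨1, 2⟩

/-- The vector spanning the image of the reduction of `U` or of its inverse. -/
def dominantVec (e : Bool) : Fin 3 → F9 := bif e then ![0, 1, 0] else ![1, 0, 0]

theorem diagNum_iF9 : ∀ e, diagNum iF9 e =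
    vecMulVec (diagNum iF9 e *ᵥ dominantVec e) (dominantVec e) := by
  decide

theorem conj_pairing_ne_zero : ∀ l m : Bool × Bool, (l.1 = m.1 → l.2 = m.2) →
    (dominantVec l.2 ᵥ* conjRight iF9 bF9 l.1) ⬝ᵥ
      (conjLeft iF9 bF9 m.1 *ᵥ (diagNum iF9 m.2 *ᵥ dominantVec m.2)) ≠ 0 := by
  simp only [conjLeft, conjRight, cayleyNum, cayleyDen, adjugate_fin_three_of]
  decide

theorem det_cayleyNum_ne_zero : (cayleyNum iF9 bF9).det ≠ 0 := by
  simp only [cayleyNum, det_fin_three]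
  decide

theorem det_cayleyDen_ne_zero : (cayleyDen iF9 bF9).det ≠ 0 := by
  simp only [cayleyDen, det_fin_three]
  decide

end Reduction

section Assembly

open Matrix

theorem adjugate_eq_smul_inv {L : Type*} [Field L] (g : GL (Fin 3) L) :
    (g : Matrix (Fin 3) (Fin 3) L).adjugate =
      (g : Matrix (Fin 3) (Fin 3) L).det • ((g⁻¹ : GL (Fin 3) L) : Matrix (Fin 3) (Fin 3) L) := by
  rw [Matrix.coe_units_inv, Matrix.inv_def, smul_smul, Ring.mul_inverse_cancel, one_smul]
  exact (Matrix.isUnit_iff_isUnit_det _).mp g.isUnit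

/-- The pair `U`, `V⁻¹ U V` is free whenever `i` and `b` are algebraically independent over `𝔽₃`. -/
theorem isFreePair_of_injective {L : Type*} [Field L]
    (φ : MvPolynomial (Fin 2) (ZMod 3) →+* L) (hφ : Function.Injective φ)
    (i b : L) (hi : φ (MvPolynomial.X 0) = i) (hb : φ (MvPolynomial.X 1) = b)
    (U P Q : GL (Fin 3) L) (hP : (P : Matrix (Fin 3) (Fin 3) L) = cayleyNum i b)
    (hQ : (Q : Matrix (Fin 3) (Fin 3) L) = cayleyDen i b) (c : Bool → L)
    (hU : ∀ e, diagNum i e = c e • ((bif e then U else U⁻¹ : GL (Fin 3) L) :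
      Matrix (Fin 3) (Fin 3) L)) :
    IsFreePair U ((P * Q⁻¹)⁻¹ * U * (P * Q⁻¹)) := by
  let ψ : MvPolynomial (Fin 2) (ZMod 3) →+* F9 :=
    MvPolynomial.eval₂Hom (algebraMap (ZMod 3) F9) ![iF9, bF9]
  have hψi : ψ (MvPolynomial.X 0) = iF9 := by simp [ψ]
  have hψb : ψ (MvPolynomial.X 1) = bF9 := by simp [ψ]
  let cV : Bool → L := fun g => bif g then 1 else P.val.det
  let cW : Bool → L := fun g => bif g then 1 else Q.val.det
  refine lift_injective_of_rank_one_reduction φ hφ ψ _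
    (fun l => conjLeft (MvPolynomial.X 0) (MvPolynomial.X 1) l.1 * diagNum (MvPolynomial.X 0) l.2 *
      conjRight (MvPolynomial.X 0) (MvPolynomial.X 1) l.1)
    (fun l => cV l.1 * c l.2 * cW l.1)
    (fun l => conjLeft iF9 bF9 l.1 *ᵥ (diagNum iF9 l.2 *ᵥ dominantVec l.2))
    (fun l => dominantVec l.2 ᵥ* conjRight iF9 bF9 l.1) ?_ ?_ conj_pairing_ne_zero
  · rintro ⟨g, e⟩
    have hl : conjLeft i b false = P.val.det • (((P * Q⁻¹)⁻¹ : GL (Fin 3) L) : Matrix _ _ L) := by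
      simp only [conjLeft, cond_false, ← hP, ← hQ, adjugate_eq_smul_inv, mul_smul_comm,
        _root_.mul_inv_rev, inv_inv, Units.val_mul]
    have hr : conjRight i b false = Q.val.det • ((P * Q⁻¹ : GL (Fin 3) L) : Matrix _ _ L) := by
      simp only [conjRight, cond_false, ← hP, ← hQ, adjugate_eq_smul_inv, mul_smul_comm,
        Units.val_mul]
    simp only [map_mul, map_conjLeft, map_conjRight, map_diagNum, hi, hb]
    cases g
    · rw [hl, hr, hU e, smul_mul_smul_comm, smul_mul_smul_comm]
      simp only [cV, cW, cond_false, ← Units.val_mul]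
      cases e <;> simp [mul_assoc]
    · simp only [conjLeft, conjRight, cV, cW, cond_true, hU e]
      simp
  · rintro ⟨g, e⟩
    simp only [map_mul, map_conjLeft, map_conjRight, map_diagNum, hψi, hψb]
    rw [diagNum_iF9 e, mul_vecMulVec, vecMulVec_mul, ← diagNum_iF9 e]

end Assembly

theorem free_pair_in_cyclic_algebra_symmetric_case
    (L : Type*) [Field L] [Algebra Kfield L]
    (i : L) (hi : i ^ 3 - i = algebraMap Kfield L aK) :
    (1 + i ^ 2 ≠ 0) ∧ (1 + (i + 1) ^ 2 ≠ 0) ∧ (1 + (i + 2) ^ 2 ≠ 0) ∧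
    ∀ (b : L) (W U : Matrix (Fin 3) (Fin 3) L),
      b = algebraMap Kfield L bK →
      W = !![0, 2 * i, b⁻¹ * (i + 1) ^ 2;
             i ^ 2, 0, 2 * i + 1;
             2 * b * (i + 1), (i + 2) ^ 2, 0] →
      U = !![(1 + i ^ 2) * (1 + (i + 1) ^ 2)⁻¹, 0, 0;
             0, (1 + (i + 2) ^ 2) * (1 + i ^ 2)⁻¹, 0;
             0, 0, (1 + (i + 1) ^ 2) * (1 + (i + 2) ^ 2)⁻¹] →
      IsUnit ((1 : Matrix (Fin 3) (Fin 3) L) - W) ∧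
      IsUnit ((1 : Matrix (Fin 3) (Fin 3) L) + W) ∧
      ∃ Ug Vg : Matrix.GeneralLinearGroup (Fin 3) L,
        (Ug : Matrix (Fin 3) (Fin 3) L) = U ∧
        (Vg : Matrix (Fin 3) (Fin 3) L) = (1 + W) * (1 - W)⁻¹ ∧
        IsFreePair Ug (Vg⁻¹ * Ug * Vg) := by
  obtain ⟨φ, hφ, hφi, hφb⟩ := exists_injective_eval L i hi
  have hne (x : F9) (y : F9) (p : MvPolynomial (Fin 2) (ZMod 3))
      (h : MvPolynomial.eval₂Hom (algebraMap (ZMod 3) F9) ![x, y] p ≠ 0) : φ p ≠ 0 := by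
    rw [map_ne_zero_iff φ hφ]
    rintro rfl
    exact h (map_zero _)
  have h0 : 1 + i ^ 2 ≠ 0 := by
    have := hne 0 0 (1 + MvPolynomial.X 0 ^ 2) (by simp)
    simpa [hφi] using this
  have h1 : 1 + (i + 1) ^ 2 ≠ 0 := by
    have := hne 0 0 (1 + (MvPolynomial.X 0 + 1) ^ 2) (by simp; decide)
    simpa [hφi] using this
  have h2 : 1 + (i + 2) ^ 2 ≠ 0 := by
    have := hne 0 0 (1 + (MvPolynomial.X 0 + 2) ^ 2) (by simp; decide)
    simpa [hφi, map_ofNat φ 2] using this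
  refine ⟨h0, h1, h2, ?_⟩
  rintro b W U rfl hW hU
  rw [← hφb] at hW
  have hb : φ (MvPolynomial.X 1) ≠ 0 := hne 0 1 _ (by simp)
  generalize hbb : φ (MvPolynomial.X 1) = b at *
  have hP : (cayleyNum i b).det ≠ 0 := by
    have := hne iF9 bF9 (cayleyNum (MvPolynomial.X 0) (MvPolynomial.X 1)).det
      (by
        rw [RingHom.map_det, map_cayleyNum]
        simpa using det_cayleyNum_ne_zero)
    rwa [RingHom.map_det, map_cayleyNum, hφi, hbb] at this
  have hQ : (cayleyDen i b).det ≠ 0 := by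
    have := hne iF9 bF9 (cayleyDen (MvPolynomial.X 0) (MvPolynomial.X 1)).det
      (by
        rw [RingHom.map_det, map_cayleyDen]
        simpa using det_cayleyDen_ne_zero)
    rwa [RingHom.map_det, map_cayleyDen, hφi, hbb] at this
  have hPW : 1 + W = b⁻¹ • cayleyNum i b := by
    subst hW
    ext p q
    fin_cases p <;> fin_cases q <;> simp [cayleyNum] <;> field_simp
  have hQW : 1 - W = b⁻¹ • cayleyDen i b := by
    subst hW
    ext p q
    fin_cases p <;> fin_cases q <;> simp [cayleyDen] <;> field_simp
    ring
  have hb' : IsUnit (b⁻¹) := (inv_ne_zero hb).isUnit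
  have hPu : IsUnit (cayleyNum i b) := (Matrix.isUnit_iff_isUnit_det _).mpr hP.isUnit
  have hQu : IsUnit (cayleyDen i b) := (Matrix.isUnit_iff_isUnit_det _).mpr hQ.isUnit
  have hUdet : U.det ≠ 0 := by
    subst hU
    simp [Matrix.det_fin_three, h0, h1, h2]
  have hUu : IsUnit U := (Matrix.isUnit_iff_isUnit_det _).mpr hUdet.isUnit
  refine ⟨?_, ?_, hUu.unit, hPu.unit * hQu.unit⁻¹, rfl, ?_, ?_⟩
  · rw [hQW, ← hb'.unit_spec, ← Units.smul_def, isUnit_smul_iff]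
    exact hQu
  · rw [hPW, ← hb'.unit_spec, ← Units.smul_def, isUnit_smul_iff]
    exact hPu
  · rw [hPW, hQW, Units.val_mul, Matrix.coe_units_inv, IsUnit.unit_spec, IsUnit.unit_spec]
    rw [← hb'.unit_spec, ← Units.smul_def, ← Units.smul_def, Matrix.inv_smul' _ _ hQ.isUnit,
      smul_mul_smul_comm, mul_inv_cancel, one_smul]
  · refine isFreePair_of_injective φ hφ i b hφi hbb _ _ _ rfl rfl
      (fun _ => (1 + i ^ 2) * (1 + (i + 1) ^ 2) * (1 + (i + 2) ^ 2)) ?_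
    have hUi : U⁻¹ = !![(1 + i ^ 2)⁻¹ * (1 + (i + 1) ^ 2), 0, 0;
        0, (1 + (i + 2) ^ 2)⁻¹ * (1 + i ^ 2), 0;
        0, 0, (1 + (i + 1) ^ 2)⁻¹ * (1 + (i + 2) ^ 2)] := by
      apply Matrix.inv_eq_right_inv
      subst hU
      ext p q
      fin_cases p <;> fin_cases q <;> simp [Matrix.mul_apply, Fin.sum_univ_three] <;> field_simp
    rintro (_ | _)
    · rw [cond_false, Matrix.coe_units_inv, IsUnit.unit_spec, hUi]
      ext p q
      fin_cases p <;> fin_cases q <;> simp [diagNum] <;> field_simp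
    · rw [cond_true, IsUnit.unit_spec, hU]
      ext p q
      fin_cases p <;> fin_cases q <;> simp [diagNum] <;> field_simp
end

section
/- Let K be the field of rational functions in a, b over 𝔽₃ and let L be a field extension of K containing an element i with i³ − i = a. Then a ≠ 0 and 1 + b ≠ 0 in K, and, letting U be the 3×3 diagonal matrix over L with diagonal entries (2/a)·(i+1)²(i+2), (2/a)·i²(i+1), (2/a)·(i+2)²·i, and V the 3×3 matrix (1+b)⁻¹·M where M has rows (1+2b, 1, 2), (2b, 1+2b, 1), (b, 2b, 1+2b), the matrices U and V are invertible and U and V⁻¹UV form a free pair in GL(3, L). -/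
open Matrix in
/-- `g` is, up to a nonzero scalar, the image under `φ` of a matrix over `P` whose image
under `ψ` is `A`. -/
def ReducesTo {n P L F : Type*} [CommRing P] [Field L] [CommRing F]
    (φ : P →+* L) (ψ : P →+* F) (g : Matrix n n L) (A : Matrix n n F) : Prop :=
  ∃ (N : Matrix n n P) (c : L), c ≠ 0 ∧ N.map φ = c • g ∧ N.map ψ = A

section ReducesTo

open Matrix

variable {n P L F : Type*} [CommRing P] [Field L] [CommRing F]
  {φ : P →+* L} {ψ : P →+* F}

theorem ReducesTo.mul [Fintype n] {g h : Matrix n n L} {A B : Matrix n n F}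
    (hg : ReducesTo φ ψ g A) (hh : ReducesTo φ ψ h B) : ReducesTo φ ψ (g * h) (A * B) := by
  obtain ⟨N, c, hc, h1, h2⟩ := hg
  obtain ⟨N', c', hc', h1', h2'⟩ := hh
  refine ⟨N * N', c * c', mul_ne_zero hc hc', ?_, ?_⟩
  · rw [Matrix.map_mul, h1, h1', Matrix.smul_mul, Matrix.mul_smul, smul_smul]
  · rw [Matrix.map_mul, h2, h2']

theorem ReducesTo.inv [Fintype n] [DecidableEq n] (g : GL n L) {N : Matrix n n P} {c : L}
    (hc : c ≠ 0) (h : (g : Matrix n n L) * N.map φ = c • 1) {A : Matrix n n F}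
    (hA : N.map ψ = A) : ReducesTo φ ψ ((g⁻¹ : GL n L) : Matrix n n L) A := by
  refine ⟨N, c, hc, ?_, hA⟩
  calc N.map φ = ((g⁻¹ : GL n L) : Matrix n n L) * (g : Matrix n n L) * N.map φ := by
        rw [← Units.val_mul, inv_mul_cancel, Units.val_one, one_mul]
    _ = c • ((g⁻¹ : GL n L) : Matrix n n L) := by
        rw [mul_assoc, h, Matrix.mul_smul, mul_one]

theorem ReducesTo.exists_scalar_of_one [DecidableEq n] (hφ : Function.Injective φ)
    {A : Matrix n n F} (h : ReducesTo φ ψ (1 : Matrix n n L) A) :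
    (∀ p q, p ≠ q → A p q = 0) ∧ ∀ p q, A p p = A q q := by
  obtain ⟨N, c, -, h1, rfl⟩ := h
  have key (p q) : φ (N p q) = c * (1 : Matrix n n L) p q := congr_fun (congr_fun h1 p) q
  refine ⟨fun p q hpq => ?_, fun p q => ?_⟩
  · have : N p q = 0 := hφ (by rw [key, one_apply_ne hpq, mul_zero, map_zero])
    rw [map_apply, this, map_zero]
  · have : N p p = N q q := hφ (by rw [key, key, one_apply_eq, one_apply_eq])
    rw [map_apply, map_apply, this]

/-- A nonzero matrix of rank one and size at least two is not scalar. -/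
theorem not_reducesTo_one_vecMulVec [IsDomain F] [DecidableEq n] [Nontrivial n]
    (hφ : Function.Injective φ) {k : F} (hk : k ≠ 0) {x y : n → F} (hx : x ≠ 0) (hy : y ≠ 0) :
    ¬ ReducesTo φ ψ (1 : Matrix n n L) (k • vecMulVec x y) := by
  intro h
  obtain ⟨h0, h1⟩ := h.exists_scalar_of_one hφ
  obtain ⟨p, hp⟩ := Function.ne_iff.1 hx
  obtain ⟨q, hq⟩ := Function.ne_iff.1 hy
  have off (p q) (hpq : p ≠ q) : x p = 0 ∨ y q = 0 := by
    simpa [vecMulVec_apply, hk] using h0 p q hpq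
  have diag (p q) : x p * y p = x q * y q := by
    simpa [vecMulVec_apply, hk] using h1 p q
  obtain rfl : p = q := by
    by_contra hpq
    exact (off p q hpq).elim hp hq
  obtain ⟨j, hj⟩ := exists_ne p
  have hxj : x j = 0 := (off j p hj).resolve_right hq
  have := diag p j
  rw [hxj, zero_mul] at this
  exact mul_ne_zero hp hq this

variable [Fintype n] [DecidableEq n]

/-- If the letters `u`, `u⁻¹`, `v`, `v⁻¹` all reduce to rank one matrices, and the product of
two letters that do not cancel reduces to a nonzero matrix, then `u` and `v` are free. -/
theorem isFreePair_of_reducesTo [IsDomain F] [Nontrivial n] (hφ : Function.Injective φ)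
    (u v : GL n L) (col row : Bool × Bool → n → F)
    (hred : ∀ x : Bool × Bool,
      ReducesTo φ ψ ((cond x.2 (if x.1 then u else v) (if x.1 then u else v)⁻¹ : GL n L) :
        Matrix n n L) (vecMulVec (col x) (row x)))
    (hne : ∀ x y : Bool × Bool, (x.1 = y.1 → x.2 = y.2) → row x ⬝ᵥ col y ≠ 0) :
    IsFreePair u v := by
  have hcol (x) : col x ≠ 0 := fun h => hne x x (fun _ => rfl) (by rw [h, dotProduct_zero])
  have hrow (x) : row x ≠ 0 := fun h => hne x x (fun _ => rfl) (by rw [h, zero_dotProduct])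
  have word (l : List (Bool × Bool)) : ∀ x, FreeGroup.IsReduced (x :: l) →
      ∃ k : F, k ≠ 0 ∧ ∃ z, ReducesTo φ ψ
        ((FreeGroup.lift (fun b : Bool => if b then u else v) (FreeGroup.mk (x :: l)) : GL n L) :
          Matrix n n L) (k • vecMulVec (col x) (row z)) := by
    induction l with
    | nil =>
      intro x _
      refine ⟨1, one_ne_zero, x, ?_⟩
      simpa [FreeGroup.lift_mk] using hred x
    | cons y l ih =>
      intro x hl
      rw [FreeGroup.IsReduced, List.isChain_cons_cons] at hl
      obtain ⟨k, hk, z, hz⟩ := ih y hl.2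
      refine ⟨k * (row x ⬝ᵥ col y), mul_ne_zero hk (hne x y hl.1), z, ?_⟩
      have := (hred x).mul hz
      rw [Matrix.mul_smul, vecMulVec_mul_vecMulVec, vecMulVec_smul, smul_smul] at this
      rw [FreeGroup.lift_mk] at this ⊢
      rwa [List.map_cons, List.prod_cons, Units.val_mul]
  refine (injective_iff_map_eq_one _).2 fun w hw => ?_
  by_contra hw1
  have hred' : FreeGroup.IsReduced w.toWord := FreeGroup.isReduced_toWord
  rw [← FreeGroup.mk_toWord (x := w)] at hw
  cases hl : w.toWord with
  | nil => exact hw1 (FreeGroup.toWord_eq_nil_iff.1 hl)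
  | cons x l =>
    rw [hl] at hw hred'
    obtain ⟨k, hk, z, hz⟩ := word l x hred'
    rw [hw, Units.val_one] at hz
    exact not_reducesTo_one_vecMulVec hφ hk (hcol x) (hrow z) hz

end ReducesTo

section Embedding

open MvPolynomial

theorem RingHom.IsIntegral.injective_of_comp {R S T : Type*} [CommRing R] [Nontrivial R]
    [CommRing S] [IsDomain S] [CommRing T] {θ : R →+* S} (hθ : θ.IsIntegral) {φ : S →+* T}
    (h : Function.Injective (φ.comp θ)) : Function.Injective φ := by
  algebraize [θ]
  rw [RingHom.injective_iff_ker_eq_bot]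
  refine Ideal.eq_bot_of_comap_eq_bot (R := R) ?_
  rw [RingHom.comap_ker, ← RingHom.injective_iff_ker_eq_bot]
  exact h

/-- Replacing the first of two algebraically independent elements by a root `i` of
`T ^ 3 - T - a` preserves algebraic independence. -/
theorem injective_eval₂Hom_of_cube_sub {k L : Type*} [Field k] [Field L] (f : k →+* L)
    (i a b : L) (hi : i ^ 3 - i = a)
    (hab : Function.Injective (eval₂Hom f ![a, b] : MvPolynomial (Fin 2) k →+* L)) :
    Function.Injective (eval₂Hom f ![i, b] : MvPolynomial (Fin 2) k →+* L) := by
  let θ : MvPolynomial (Fin 2) k →+* MvPolynomial (Fin 2) k :=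
    eval₂Hom C ![X 0 ^ 3 - X 0, X 1]
  have hcomp : (eval₂Hom f ![i, b]).comp θ = eval₂Hom f ![a, b] := by
    refine MvPolynomial.ringHom_ext (fun r => by simp [θ]) fun j => ?_
    fin_cases j <;> simp [θ, hi]
  have hθ : θ.IsIntegral := by
    intro p
    induction p using MvPolynomial.induction_on with
    | C r => simpa [θ] using θ.isIntegralElem_map (x := C r)
    | add p q hp hq => exact hp.add θ hq
    | mul_X p j hp =>
      refine hp.mul θ ?_
      fin_cases j
      · refine ⟨Polynomial.X ^ 3 - Polynomial.X - Polynomial.C (X 0), by monicity!, ?_⟩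
        simp [θ]
      · simpa [θ] using θ.isIntegralElem_map (x := X 1)
  exact hθ.injective_of_comp (by rw [hcomp]; exact hab)

end Embedding

section Cayley

open Matrix

/-- The matrix `(1 + b) • V`. -/
def cayleyMatrix {R : Type*} [CommRing R] (b : R) : Matrix (Fin 3) (Fin 3) R :=
  !![1 + 2 * b, 1, 2; 2 * b, 1 + 2 * b, 1; b, 2 * b, 1 + 2 * b]

variable {R S : Type*} [CommRing R] [CommRing S]

theorem map_cayleyMatrix (f : R →+* S) (b : R) :
    (cayleyMatrix b).map f = cayleyMatrix (f b) := by
  ext p q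
  fin_cases p <;> fin_cases q <;> simp [cayleyMatrix, map_ofNat]

theorem map_adjugate_cayleyMatrix (f : R →+* S) (b : R) :
    (cayleyMatrix b).adjugate.map f = (cayleyMatrix (f b)).adjugate := by
  rw [← map_cayleyMatrix]
  exact f.map_adjugate _

theorem det_cayleyMatrix (h3 : (3 : R) = 0) (b : R) :
    (cayleyMatrix b).det = (1 + b) ^ 2 * (1 - b) := by
  simp only [cayleyMatrix, det_fin_three, of_apply, cons_val', cons_val]
  grind

theorem cayleyMatrix_apply_ne_zero [IsDomain R] (h3 : (3 : R) = 0) {b : R} (hb : b ≠ 0)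
    (hb' : 1 - b ≠ 0) (s t : Bool) : cayleyMatrix b (cond s 0 1) (cond t 0 1) ≠ 0 := by
  have h2 : (2 : R) = -1 := by grind
  cases s <;> cases t <;> simp [cayleyMatrix, h2, hb] <;> simpa [sub_eq_add_neg] using hb'

theorem adjugate_cayleyMatrix_apply_ne_zero [IsDomain R] (h3 : (3 : R) = 0) {b : R}
    (hb : b ≠ 0) (hb' : 1 + b ≠ 0) (s t : Bool) :
    (cayleyMatrix b).adjugate (cond s 0 1) (cond t 0 1) ≠ 0 := by
  have h00 : (cayleyMatrix b).adjugate 0 0 = (1 + b) ^ 2 := by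
    simp [cayleyMatrix, adjugate_fin_three]; grind
  have h01 : (cayleyMatrix b).adjugate 0 1 = -(1 + b) := by
    simp [cayleyMatrix, adjugate_fin_three]; grind
  have h10 : (cayleyMatrix b).adjugate 1 0 = -(b * (1 + b)) := by
    simp [cayleyMatrix, adjugate_fin_three]; grind
  have h11 : (cayleyMatrix b).adjugate 1 1 = (1 + b) ^ 2 := by
    simp [cayleyMatrix, adjugate_fin_three]; grind
  cases s <;> cases t <;> simp only [cond_true, cond_false, h00, h01, h10, h11]
  · exact pow_ne_zero 2 hb'
  · exact neg_ne_zero.2 (mul_ne_zero hb hb')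
  · exact neg_ne_zero.2 hb'
  · exact pow_ne_zero 2 hb'

end Cayley

open Matrix MvPolynomial in
theorem free_pair_in_cyclic_algebra_unitary_case
    (L : Type*) [Field L] [Algebra Kfield L]
    (i : L) (hi : i ^ 3 - i = algebraMap Kfield L aK) :
    (aK ≠ 0) ∧ ((1 : Kfield) + bK ≠ 0) ∧
    ∀ (a b : L) (U V : Matrix (Fin 3) (Fin 3) L),
      a = algebraMap Kfield L aK →
      b = algebraMap Kfield L bK →
      U = !![(2 / a) * ((i + 1) ^ 2 * (i + 2)), 0, 0;
             0, (2 / a) * (i ^ 2 * (i + 1)), 0;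
             0, 0, (2 / a) * ((i + 2) ^ 2 * i)] →
      V = (1 + b)⁻¹ • !![1 + 2 * b, 1, 2;
                         2 * b, 1 + 2 * b, 1;
                         b, 2 * b, 1 + 2 * b] →
      IsUnit U ∧ IsUnit V ∧
      ∃ Ug Vg : Matrix.GeneralLinearGroup (Fin 3) L,
        (Ug : Matrix (Fin 3) (Fin 3) L) = U ∧
        (Vg : Matrix (Fin 3) (Fin 3) L) = V ∧
        IsFreePair Ug (Vg⁻¹ * Ug * Vg) := by
  have hinj := FaithfulSMul.algebraMap_injective Kfield L
  have hinj' := IsFractionRing.injective (MvPolynomial (Fin 2) (ZMod 3)) Kfield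
  have haK : aK ≠ 0 := (map_ne_zero_iff _ hinj').2 (X_ne_zero 0)
  have hbK : (1 : Kfield) + bK ≠ 0 := by
    rw [bK, ← map_one (algebraMap (MvPolynomial (Fin 2) (ZMod 3)) Kfield), ← map_add]
    refine (map_ne_zero_iff _ hinj').2 fun h => ?_
    simpa using congr_arg (eval 0) h
  have hbK' : (1 : Kfield) - bK ≠ 0 := by
    rw [bK, ← map_one (algebraMap (MvPolynomial (Fin 2) (ZMod 3)) Kfield), ← map_sub]
    refine (map_ne_zero_iff _ hinj').2 fun h => ?_
    simpa using congr_arg (eval 0) h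
  refine ⟨haK, hbK, ?_⟩
  intro a b U V ha hb hU hV
  rw [← ha] at hi
  have ha0 : a ≠ 0 := ha ▸ (map_ne_zero_iff _ hinj).2 haK
  have hb1 : 1 + b ≠ 0 := by
    rw [hb, ← map_one (algebraMap Kfield L), ← map_add]
    exact (map_ne_zero_iff _ hinj).2 hbK
  have hb2 : 1 - b ≠ 0 := by
    rw [hb, ← map_one (algebraMap Kfield L), ← map_sub]
    exact (map_ne_zero_iff _ hinj).2 hbK'
  let f : ZMod 3 →+* L :=
    (algebraMap Kfield L).comp ((algebraMap (MvPolynomial (Fin 2) (ZMod 3)) Kfield).comp C)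
  have h3 : (3 : L) = 0 := by
    rw [← map_ofNat f 3, ← map_zero f]
    exact congr_arg f (by decide)
  have h3' : (3 : Polynomial (ZMod 3)) = 0 := by
    exact_mod_cast CharP.cast_eq_zero (Polynomial (ZMod 3)) 3
  have h2' : (2 : Polynomial (ZMod 3)) = -1 := by linear_combination h3'
  let φ : MvPolynomial (Fin 2) (ZMod 3) →+* L := eval₂Hom f ![i, b]
  let ψ : MvPolynomial (Fin 2) (ZMod 3) →+* Polynomial (ZMod 3) :=
    eval₂Hom Polynomial.C ![0, Polynomial.X]
  have hφ : Function.Injective φ := by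
    refine injective_eval₂Hom_of_cube_sub f i a b hi ?_
    have : (eval₂Hom f ![a, b] : MvPolynomial (Fin 2) (ZMod 3) →+* L) =
        (algebraMap Kfield L).comp (algebraMap (MvPolynomial (Fin 2) (ZMod 3)) Kfield) := by
      refine MvPolynomial.ringHom_ext (fun r => by simp [f]) fun j => ?_
      fin_cases j
      · simp [ha, aK]
      · simp [hb, bK]
    rw [this]
    exact hinj.comp hinj'
  have hφ0 : φ (X 0) = i := by simp [φ]
  have hφ1 : φ (X 1) = b := by simp [φ]
  have hψ0 : ψ (X 0) = 0 := by simp [ψ]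
  have hψ1 : ψ (X 1) = Polynomial.X := by simp [ψ]
  have hprod : a = i * (i + 1) * (i + 2) := by grind
  have hi0 : i ≠ 0 := by rintro rfl; simp [hprod] at ha0
  have hi1 : i + 1 ≠ 0 := by intro h; simp [hprod, h] at ha0
  have hi2 : i + 2 ≠ 0 := by intro h; simp [hprod, h] at ha0
  have h20 : (2 : L) ≠ 0 := by
    intro h
    exact one_ne_zero (show (1 : L) = 0 by linear_combination h3 - h)
  have hVM : cayleyMatrix b = (1 + b) • V := by
    rw [hV, smul_smul, mul_inv_cancel₀ hb1, one_smul, cayleyMatrix]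
  have hdet : (cayleyMatrix b).det ≠ 0 := by
    rw [det_cayleyMatrix h3]
    exact mul_ne_zero (pow_ne_zero 2 hb1) hb2
  have hUu : IsUnit U := by
    rw [isUnit_iff_isUnit_det, isUnit_iff_ne_zero, hU]
    simp [det_fin_three, ha0, hi0, hi1, hi2, h20]
  have hVu : IsUnit V := by
    rw [isUnit_iff_isUnit_det, isUnit_iff_ne_zero]
    intro h
    rw [hVM, det_smul, h, mul_zero] at hdet
    exact hdet rfl
  obtain ⟨Ug, rfl⟩ := hUu
  obtain ⟨Vg, rfl⟩ := hVu
  refine ⟨Ug.isUnit, Vg.isUnit, Ug, Vg, rfl, rfl, ?_⟩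
  let e (s : Bool) : Fin 3 → Polynomial (ZMod 3) := Pi.single (cond s 0 1) 1
  let M : Matrix (Fin 3) (Fin 3) (Polynomial (ZMod 3)) := cayleyMatrix Polynomial.X
  have redU : ReducesTo φ ψ (Ug : Matrix (Fin 3) (Fin 3) L) (vecMulVec (e true) (e true)) := by
    refine ⟨diagonal ![2 * ((X 0 + 1) ^ 2 * (X 0 + 2)), 2 * (X 0 ^ 2 * (X 0 + 1)),
      2 * ((X 0 + 2) ^ 2 * X 0)], a, ha0, ?_, ?_⟩
    · rw [hU]
      ext p q
      fin_cases p <;> fin_cases q <;> simp [hφ0, map_ofNat] <;> field_simp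
    · ext1 p q
      fin_cases p <;> fin_cases q <;> simp [hψ0, h2', e, vecMulVec_apply, map_ofNat]
  have redU' : ReducesTo φ ψ ((Ug⁻¹ : GL (Fin 3) L) : Matrix (Fin 3) (Fin 3) L)
      (vecMulVec (e false) (e false)) := by
    refine ReducesTo.inv Ug (N := diagonal ![X 0 ^ 2 * (X 0 + 2), (X 0 + 2) ^ 2 * (X 0 + 1),
      (X 0 + 1) ^ 2 * X 0]) (c := 2 * a) (mul_ne_zero h20 ha0) ?_ ?_
    · rw [hU]
      ext p q
      fin_cases p <;> fin_cases q <;> simp [hφ0, map_ofNat] <;> field_simp <;> rw [hprod] <;> ring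
    · ext1 p q
      fin_cases p <;> fin_cases q <;> simp [hψ0, h2', e, vecMulVec_apply, map_ofNat]
  have redV : ReducesTo φ ψ (Vg : Matrix (Fin 3) (Fin 3) L) M :=
    ⟨cayleyMatrix (X 1), 1 + b, hb1, by rw [map_cayleyMatrix, hφ1, hVM],
      by rw [map_cayleyMatrix, hψ1]⟩
  have redV' : ReducesTo φ ψ ((Vg⁻¹ : GL (Fin 3) L) : Matrix (Fin 3) (Fin 3) L) M.adjugate := by
    refine ReducesTo.inv Vg (N := (cayleyMatrix (X 1)).adjugate)
      (c := (1 + b)⁻¹ * (cayleyMatrix b).det) (mul_ne_zero (inv_ne_zero hb1) hdet) ?_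
      (by rw [map_adjugate_cayleyMatrix, hψ1])
    rw [map_adjugate_cayleyMatrix, hφ1, mul_smul, ← mul_adjugate, ← Matrix.smul_mul]
    nth_rw 2 [hVM]
    rw [smul_smul, inv_mul_cancel₀ hb1, one_smul]
  refine isFreePair_of_reducesTo (ψ := ψ) hφ _ _
    (fun x => if x.1 then e x.2 else M.adjugate *ᵥ e x.2)
    (fun x => if x.1 then e x.2 else e x.2 ᵥ* M) ?_ ?_
  · rintro ⟨_ | _, _ | _⟩
    · simpa [mul_assoc, mul_vecMulVec, vecMulVec_mul] using (redV'.mul redU').mul redV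
    · simpa [mul_assoc, mul_vecMulVec, vecMulVec_mul] using (redV'.mul redU).mul redV
    · simpa using redU'
    · simpa using redU
  · have hX : (Polynomial.X : Polynomial (ZMod 3)) ≠ 0 := Polynomial.X_ne_zero
    have hX1 : (1 : Polynomial (ZMod 3)) + Polynomial.X ≠ 0 := by
      rw [add_comm]; exact Polynomial.X_add_C_ne_zero 1
    have hX2 : (1 : Polynomial (ZMod 3)) - Polynomial.X ≠ 0 := by
      rw [← neg_sub, neg_ne_zero]; exact Polynomial.X_sub_C_ne_zero 1
    rintro ⟨_ | _, s⟩ ⟨_ | _, t⟩ hst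
    · obtain rfl : s = t := hst rfl
      have : e s ᵥ* M ⬝ᵥ M.adjugate *ᵥ e s = M.det := by
        rw [← dotProduct_mulVec, mulVec_mulVec, mul_adjugate]
        simp [e]
      simp only [Bool.false_eq_true, if_false]
      rw [this, det_cayleyMatrix h3']
      exact mul_ne_zero (pow_ne_zero 2 hX1) hX2
    · simpa [e] using cayleyMatrix_apply_ne_zero h3' hX hX2 s t
    · simpa [e] using adjugate_cayleyMatrix_apply_ne_zero h3' hX hX1 s t
    · obtain rfl : s = t := hst rfl
      simp [e]
end
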